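/- arXiv:2603.25094 — 5 statements merged into one kernel-verified Lean document; each statement's English description precedes it below -/
import Mathlib

section
/- For every integer n ≥ 1 there exists a constant C > 0, depending only on n, with the following property: for every bounded convex open set D ⊂ ℝⁿ, every pair of open subsets D₁, D₂ ⊆ D with vol(D₂) > 0, and every continuously differentiable function u : ℝⁿ → ℝ, one has ∫_{D₁} u² dx ≤ (2·vol(D₁)/vol(D₂)) ∫_{D₂} u² dx + C·(diam D)^{n+1}·(vol D₁)^{1/n}·(vol D₂)⁻¹ ∫_D ‖∇u‖² dx. -/
open MeasureTheory Metric Set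
open scoped ENNReal

theorem sq_integral_zero_one_le {h : ℝ → ℝ} (hh : Continuous h) :
    (∫ t in (0 : ℝ)..1, h t) ^ 2 ≤ ∫ t in (0 : ℝ)..1, h t ^ 2 := by
  set c := ∫ t in (0 : ℝ)..1, h t with hc
  have hnonneg : 0 ≤ ∫ t in (0 : ℝ)..1, (h t - c) ^ 2 :=
    intervalIntegral.integral_nonneg zero_le_one fun t _ ↦ sq_nonneg _
  have hexpand : ∫ t in (0 : ℝ)..1, (h t - c) ^ 2 = (∫ t in (0 : ℝ)..1, h t ^ 2) - c ^ 2 := by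
    have : ∀ t, (h t - c) ^ 2 = h t ^ 2 - 2 * c * h t + c ^ 2 := fun t ↦ by ring
    simp_rw [this]
    rw [intervalIntegral.integral_add, intervalIntegral.integral_sub,
      intervalIntegral.integral_const_mul, ← hc]
    · simp; ring
    all_goals exact Continuous.intervalIntegrable (by fun_prop) _ _
  linarith

section
variable {E : Type*} [NormedAddCommGroup E] [InnerProductSpace ℝ E]

theorem norm_gradient_eq_norm_fderiv [CompleteSpace E] (u : E → ℝ) (x : E) :
    ‖gradient u x‖ = ‖fderiv ℝ u x‖ := by
  simp [gradient]

theorem ContDiff.continuous_gradient [CompleteSpace E] {u : E → ℝ} (hu : ContDiff ℝ 1 u) :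
    Continuous (gradient u) :=
  (InnerProductSpace.toDual ℝ E).symm.continuous.comp (hu.continuous_fderiv one_ne_zero)

theorem sq_sub_le_integral_segment [CompleteSpace E] {u : E → ℝ} (hu : ContDiff ℝ 1 u) (x y : E) :
    (u x - u y) ^ 2 ≤
      ‖y - x‖ ^ 2 * ∫ t in (0 : ℝ)..1, ‖gradient u (x + t • (y - x))‖ ^ 2 := by
  have hg := hu.continuous_gradient
  have hderiv : ∀ t : ℝ, HasDerivAt (fun t : ℝ ↦ u (x + t • (y - x)))
      (fderiv ℝ u (x + t • (y - x)) (y - x)) t := fun t ↦ by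
    have h1 : HasDerivAt (fun t : ℝ ↦ x + t • (y - x)) (y - x) t := by
      simpa using ((hasDerivAt_id t).smul_const (y - x)).const_add x
    exact ((hu.differentiable one_ne_zero) _).hasFDerivAt.comp_hasDerivAt t h1
  have hcont : Continuous fun t : ℝ ↦ fderiv ℝ u (x + t • (y - x)) (y - x) :=
    ((hu.continuous_fderiv one_ne_zero).comp (by fun_prop)).clm_apply continuous_const
  have hftc := intervalIntegral.integral_eq_sub_of_hasDerivAt (a := 0) (b := 1)
    (fun t _ ↦ hderiv t) (hcont.intervalIntegrable _ _)
  simp only [one_smul, add_sub_cancel, zero_smul, add_zero] at hftc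
  calc (u x - u y) ^ 2 = (∫ t in (0 : ℝ)..1, fderiv ℝ u (x + t • (y - x)) (y - x)) ^ 2 := by
        rw [hftc]; ring
    _ ≤ ∫ t in (0 : ℝ)..1, (fderiv ℝ u (x + t • (y - x)) (y - x)) ^ 2 :=
        sq_integral_zero_one_le hcont
    _ ≤ ∫ t in (0 : ℝ)..1, ‖y - x‖ ^ 2 * ‖gradient u (x + t • (y - x))‖ ^ 2 := by
        refine intervalIntegral.integral_mono zero_le_one
          ((hcont.pow 2).intervalIntegrable _ _)
          (Continuous.intervalIntegrable (by fun_prop) _ _) fun t ↦ ?_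
        rw [norm_gradient_eq_norm_fderiv, ← mul_pow, ← sq_abs, mul_comm, ← Real.norm_eq_abs]
        gcongr
        exact ContinuousLinearMap.le_opNorm _ _
    _ = _ := intervalIntegral.integral_const_mul _ _
end

/-- The weight produced by changing variables along segments: `s` is the distance from the base
point to the point at parameter `t` of a segment of length at most `d`. -/
noncomputable def segmentWeight (d t s : ℝ) : ℝ := if s ≤ t * d then d * (s / t) else 0

theorem measurable_segmentWeight (d : ℝ) :
    Measurable fun p : ℝ × ℝ ↦ segmentWeight d p.1 p.2 := by
  unfold segmentWeight
  refine Measurable.ite (measurableSet_le ?_ ?_) ?_ measurable_const <;> fun_prop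

theorem lintegral_segmentWeight_le {n : ℕ} (hn : 1 ≤ n) {d s : ℝ} (hd : 0 ≤ d) (hs : 0 ≤ s) :
    ∫⁻ t in Ioc (0 : ℝ) 1, ENNReal.ofReal ((t ^ n)⁻¹ * segmentWeight d t s) ≤
      ENNReal.ofReal (d ^ (n + 1) * (s ^ (n - 1))⁻¹) := by
  rcases hs.eq_or_lt with rfl | hs
  · simp [segmentWeight]
  rcases hd.eq_or_lt with rfl | hd
  · simp [segmentWeight]
  have ha : 0 < s / d := by positivity
  have hexp : -((n : ℝ) + 1) < -1 := by
    have : (1 : ℝ) ≤ n := by exact_mod_cast hn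
    linarith
  calc ∫⁻ t in Ioc (0 : ℝ) 1, ENNReal.ofReal ((t ^ n)⁻¹ * segmentWeight d t s)
      ≤ ∫⁻ t in Ioc (0 : ℝ) 1, (Ici (s / d)).indicator
          (fun t ↦ ENNReal.ofReal (d * s * t ^ (-((n : ℝ) + 1)))) t := by
        refine setLIntegral_mono' measurableSet_Ioc fun t ht ↦ ?_
        have ht0 : 0 < t := ht.1
        by_cases hst : s ≤ t * d
        · rw [indicator_of_mem (by rwa [mem_Ici, div_le_iff₀ hd]), segmentWeight, if_pos hst]
          refine le_of_eq (congrArg _ ?_)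
          rw [Real.rpow_neg ht0.le, Real.rpow_add_one ht0.ne', Real.rpow_natCast]
          field_simp
        · simp [segmentWeight, hst]
    _ ≤ ∫⁻ t, (Ici (s / d)).indicator
          (fun t ↦ ENNReal.ofReal (d * s * t ^ (-((n : ℝ) + 1)))) t := setLIntegral_le_lintegral _ _
    _ = ∫⁻ t in Ioi (s / d), ENNReal.ofReal (d * s * t ^ (-((n : ℝ) + 1))) := by
        rw [lintegral_indicator measurableSet_Ici, setLIntegral_congr Ioi_ae_eq_Ici]
    _ = ENNReal.ofReal (∫ t in Ioi (s / d), d * s * t ^ (-((n : ℝ) + 1))) := by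
        rw [ofReal_integral_eq_lintegral_ofReal
          ((integrableOn_Ioi_rpow_of_lt hexp ha).const_mul _)]
        filter_upwards [ae_restrict_mem measurableSet_Ioi] with t ht
        have : 0 < t := ha.trans ht
        simp only [Pi.zero_apply]
        positivity
    _ ≤ _ := by
        refine ENNReal.ofReal_le_ofReal ?_
        rw [integral_const_mul, integral_Ioi_rpow_of_lt hexp ha]
        obtain ⟨m, rfl⟩ : ∃ m, n = m + 1 := ⟨n - 1, by omega⟩
        have hexp' : -(((m + 1 : ℕ) : ℝ) + 1) + 1 = -((m + 1 : ℕ) : ℝ) := by ring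
        rw [hexp', Real.rpow_neg ha.le, Real.rpow_natCast, neg_div_neg_eq]
        calc d * s * (((s / d) ^ (m + 1))⁻¹ / ((m + 1 : ℕ) : ℝ))
            ≤ d * s * (((s / d) ^ (m + 1))⁻¹) := by
              gcongr
              exact div_le_self (by positivity) (by simp)
          _ = _ := by
              simp only [Nat.add_sub_cancel, div_pow, pow_succ]
              field_simp

section
variable {E : Type*} [NormedAddCommGroup E] [NormedSpace ℝ E] [FiniteDimensional ℝ E]
  [MeasurableSpace E] [BorelSpace E] (μ : Measure E) [μ.IsAddHaarMeasure]

theorem lintegral_comp_add_smul_sub {F : E → ℝ≥0∞} (hF : Measurable F) (x : E) {t : ℝ}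
    (ht : 0 < t) :
    ∫⁻ y, F (x + t • (y - x)) ∂μ =
      ENNReal.ofReal ((t ^ Module.finrank ℝ E)⁻¹) * ∫⁻ z, F z ∂μ := by
  have hF' : Measurable fun w ↦ F (x + w) := by fun_prop
  rw [lintegral_sub_right_eq_self (μ := μ) (fun w ↦ F (x + t • w)) x,
    ← lintegral_map (μ := μ) (g := fun w : E ↦ t • w) hF' (by fun_prop),
    Measure.map_addHaar_smul μ ht.ne', lintegral_smul_measure,
    lintegral_add_left_eq_self F x, abs_of_pos (by positivity), smul_eq_mul]

theorem setLIntegral_ball_inv_norm_pow [Nontrivial E] {r : ℝ} (hr : 0 ≤ r) :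
    ∫⁻ x in ball (0 : E) r, ENNReal.ofReal ((‖x‖ ^ (Module.finrank ℝ E - 1))⁻¹) ∂μ =
      ENNReal.ofReal (Module.finrank ℝ E * μ.real (ball 0 1) * r) := by
  set m := Module.finrank ℝ E - 1 with hm
  have hone : EqOn (fun y : ℝ ↦ y ^ m • (y ^ m)⁻¹) 1 (Ioo 0 r) := fun y hy ↦ by
    have : 0 < y := hy.1
    simp [this.ne']
  have hint : IntegrableOn (fun x : E ↦ (‖x‖ ^ m)⁻¹) (ball 0 r) μ := by
    rw [integrableOn_fun_norm_addHaar μ (f := fun s ↦ (s ^ m)⁻¹), ← hm,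
      integrableOn_congr_fun hone measurableSet_Ioo]
    exact integrableOn_const (by simp)
  rw [← ofReal_integral_eq_lintegral_ofReal hint (.of_forall fun x ↦ by positivity)]
  congr 1
  have hind : ∀ x : E, (ball (0 : E) r).indicator (fun x ↦ (‖x‖ ^ m)⁻¹) x =
      (Iio r).indicator (fun s : ℝ ↦ (s ^ m)⁻¹) ‖x‖ := fun x ↦ by
    simp [indicator]
  rw [← integral_indicator measurableSet_ball, integral_congr_ae (.of_forall hind),
    integral_fun_norm_addHaar μ, ← hm]
  have hrad : ∫ y in Ioi (0 : ℝ), y ^ m • (Iio r).indicator (fun s : ℝ ↦ (s ^ m)⁻¹) y = r := by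
    have : ∀ y ∈ Ioi (0 : ℝ), y ^ m • (Iio r).indicator (fun s : ℝ ↦ (s ^ m)⁻¹) y =
        (Iio r).indicator 1 y := fun y hy ↦ by
      have : 0 < y := hy
      by_cases hyr : y < r <;> simp [hyr, this.ne']
    rw [setIntegral_congr_fun measurableSet_Ioi this, setIntegral_indicator measurableSet_Iio,
      Ioi_inter_Iio]
    simp [hr]
  rw [hrad]
  simp [mul_assoc]

theorem setLIntegral_inv_norm_sub_pow_le [Nontrivial E] {A : Set E}
    (hA : μ A ≠ ∞) (z : E) :
    ∫⁻ x in A, ENNReal.ofReal ((‖z - x‖ ^ (Module.finrank ℝ E - 1))⁻¹) ∂μ ≤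
      ENNReal.ofReal ((Module.finrank ℝ E * μ.real (ball 0 1) + 1) *
        μ.real A ^ ((1 : ℝ) / Module.finrank ℝ E)) := by
  by_cases hA0 : μ A = 0
  · rw [setLIntegral_measure_zero _ _ hA0]; exact zero_le
  have hv : 0 < μ.real A := ENNReal.toReal_pos hA0 hA
  have hfin : 0 < Module.finrank ℝ E := Module.finrank_pos
  set k := Module.finrank ℝ E with hk
  set r := μ.real A ^ ((1 : ℝ) / k) with hr
  have hr0 : 0 < r := by positivity
  have hrk : r ^ k = μ.real A := by
    rw [hr, ← Real.rpow_natCast, ← Real.rpow_mul hv.le]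
    field_simp
    simp
  set f : E → ℝ≥0∞ := fun w ↦ ENNReal.ofReal ((‖w‖ ^ (k - 1))⁻¹) with hf
  calc ∫⁻ x in A, f (z - x) ∂μ
      ≤ ∫⁻ x in A, ((ball (0 : E) r).indicator f (z - x) + ENNReal.ofReal ((r ^ (k - 1))⁻¹)) ∂μ := by
        refine lintegral_mono fun x ↦ ?_
        by_cases hx : z - x ∈ ball (0 : E) r
        · rw [indicator_of_mem hx]; exact le_self_add
        · rw [indicator_of_notMem hx, zero_add]
          refine ENNReal.ofReal_le_ofReal ?_
          rw [mem_ball_zero_iff, not_lt] at hx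
          gcongr
    _ = ∫⁻ x in A, (ball (0 : E) r).indicator f (z - x) ∂μ +
          ENNReal.ofReal ((r ^ (k - 1))⁻¹) * μ A := by
        rw [lintegral_add_right _ measurable_const, setLIntegral_const]
    _ ≤ ∫⁻ x, (ball (0 : E) r).indicator f (z - x) ∂μ +
          ENNReal.ofReal ((r ^ (k - 1))⁻¹) * μ A := by
        exact add_le_add_left (setLIntegral_le_lintegral _ _) _
    _ = ENNReal.ofReal (k * μ.real (ball 0 1) * r) + ENNReal.ofReal r := by
        rw [lintegral_sub_left_eq_self _ z, lintegral_indicator measurableSet_ball,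
          setLIntegral_ball_inv_norm_pow μ hr0.le, ← ofReal_measureReal hA,
          ← ENNReal.ofReal_mul (by positivity), ← hrk]
        obtain ⟨m, hm⟩ : ∃ m, k = m + 1 := ⟨k - 1, by omega⟩
        congr 2
        rw [hm, Nat.add_sub_cancel, pow_succ]
        field_simp
    _ = _ := by
        rw [← ENNReal.ofReal_add (by positivity) hr0.le]
        congr 1; ring
end

section
variable {E : Type*} [NormedAddCommGroup E] [InnerProductSpace ℝ E] [FiniteDimensional ℝ E]

theorem ofReal_sq_sub_le_lintegral_segment {D : Set E} (hD : Convex ℝ D) {d : ℝ}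
    {u : E → ℝ} (hu : ContDiff ℝ 1 u) {x y : E} (hx : x ∈ D) (hy : y ∈ D) (hxy : ‖y - x‖ ≤ d) :
    ENNReal.ofReal ((u x - u y) ^ 2) ≤
      ∫⁻ t in Ioc (0 : ℝ) 1, ENNReal.ofReal (segmentWeight d t ‖x + t • (y - x) - x‖) *
        D.indicator (fun z ↦ ENNReal.ofReal (‖gradient u z‖ ^ 2)) (x + t • (y - x)) := by
  have hg := hu.continuous_gradient
  have hcont : Continuous fun t : ℝ ↦ ‖gradient u (x + t • (y - x))‖ ^ 2 := by fun_prop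
  have hd : 0 ≤ d := (norm_nonneg _).trans hxy
  calc ENNReal.ofReal ((u x - u y) ^ 2)
      ≤ ENNReal.ofReal (d * ‖y - x‖ * ∫ t in (0 : ℝ)..1, ‖gradient u (x + t • (y - x))‖ ^ 2) := by
        refine ENNReal.ofReal_le_ofReal ((sq_sub_le_integral_segment hu x y).trans ?_)
        rw [sq ‖y - x‖]
        gcongr
        exact intervalIntegral.integral_nonneg zero_le_one fun t _ ↦ by positivity
    _ = ∫⁻ t in Ioc (0 : ℝ) 1,
          ENNReal.ofReal (d * ‖y - x‖ * ‖gradient u (x + t • (y - x))‖ ^ 2) := by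
        rw [← intervalIntegral.integral_const_mul, intervalIntegral.integral_of_le zero_le_one,
          ofReal_integral_eq_lintegral_ofReal
            ((hcont.const_mul _).integrableOn_Icc.mono_set Ioc_subset_Icc_self)]
        exact .of_forall fun t ↦ by simp only [Pi.zero_apply]; positivity
    _ = _ := by
        refine setLIntegral_congr_fun measurableSet_Ioc fun t ht ↦ ?_
        have ht0 : 0 < t := ht.1
        have hmem : x + t • (y - x) ∈ D := hD.add_smul_sub_mem hx hy (Ioc_subset_Icc_self ht)
        have hnorm : ‖x + t • (y - x) - x‖ = t * ‖y - x‖ := by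
          rw [add_sub_cancel_left, norm_smul, Real.norm_of_nonneg ht0.le]
        rw [indicator_of_mem hmem, hnorm, segmentWeight, if_pos (by gcongr),
          mul_div_cancel_left₀ _ ht0.ne', ENNReal.ofReal_mul (by positivity)]

variable [MeasurableSpace E] [BorelSpace E]

theorem setLIntegral_sq_sub_le [Nontrivial E] {D A : Set E} (hDm : MeasurableSet D)
    (hD : Convex ℝ D) (hA : MeasurableSet A) (hAD : A ⊆ D) {d : ℝ}
    (hd : ∀ x ∈ D, ∀ y ∈ D, ‖y - x‖ ≤ d) {u : E → ℝ} (hu : ContDiff ℝ 1 u) {x : E} (hx : x ∈ D) :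
    ∫⁻ y in A, ENNReal.ofReal ((u x - u y) ^ 2) ≤
      ∫⁻ z in D, ENNReal.ofReal (d ^ (Module.finrank ℝ E + 1)) *
        ENNReal.ofReal ((‖z - x‖ ^ (Module.finrank ℝ E - 1))⁻¹) *
          ENNReal.ofReal (‖gradient u z‖ ^ 2) := by
  have hd0 : 0 ≤ d := (norm_nonneg _).trans (hd x hx x hx)
  set n := Module.finrank ℝ E with hn
  set G : E → ℝ≥0∞ := D.indicator (fun z ↦ ENNReal.ofReal (‖gradient u z‖ ^ 2)) with hG
  have hGm : Measurable G := by
    have hg := hu.continuous_gradient.measurable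
    exact Measurable.indicator (by fun_prop) hDm
  set Φ : ℝ → E → ℝ≥0∞ := fun t z ↦ ENNReal.ofReal (segmentWeight d t ‖z - x‖) * G z with hΦ
  have hΦm : Measurable fun p : ℝ × E ↦ Φ p.1 p.2 :=
    ((measurable_segmentWeight d).comp (f := fun p : ℝ × E ↦ (p.1, ‖p.2 - x‖))
      (by fun_prop)).ennreal_ofReal.mul (hGm.comp measurable_snd)
  calc ∫⁻ y in A, ENNReal.ofReal ((u x - u y) ^ 2)
      ≤ ∫⁻ y in A, ∫⁻ t in Ioc (0 : ℝ) 1, Φ t (x + t • (y - x)) :=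
        setLIntegral_mono' hA fun y hy ↦
          ofReal_sq_sub_le_lintegral_segment hD hu hx (hAD hy) (hd x hx y (hAD hy))
    _ ≤ ∫⁻ y, ∫⁻ t in Ioc (0 : ℝ) 1, Φ t (x + t • (y - x)) := setLIntegral_le_lintegral _ _
    _ = ∫⁻ t in Ioc (0 : ℝ) 1, ∫⁻ y, Φ t (x + t • (y - x)) :=
        lintegral_lintegral_swap (hΦm.comp (f := fun p : E × ℝ ↦ (p.2, x + p.2 • (p.1 - x)))
          (by fun_prop)).aemeasurable
    _ = ∫⁻ t in Ioc (0 : ℝ) 1, ∫⁻ z, ENNReal.ofReal ((t ^ n)⁻¹) * Φ t z := by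
        refine setLIntegral_congr_fun measurableSet_Ioc fun t ht ↦ ?_
        have hΦt : Measurable (Φ t) := hΦm.comp (measurable_const.prodMk measurable_id)
        rw [lintegral_comp_add_smul_sub volume hΦt x ht.1, lintegral_const_mul _ hΦt]
    _ = ∫⁻ z, ∫⁻ t in Ioc (0 : ℝ) 1, ENNReal.ofReal ((t ^ n)⁻¹) * Φ t z :=
        lintegral_lintegral_swap (Measurable.mul (by fun_prop) hΦm).aemeasurable
    _ = ∫⁻ z, (∫⁻ t in Ioc (0 : ℝ) 1,
          ENNReal.ofReal ((t ^ n)⁻¹ * segmentWeight d t ‖z - x‖)) * G z := by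
        refine lintegral_congr fun z ↦ ?_
        have hw : Measurable fun t ↦ segmentWeight d t ‖z - x‖ :=
          (measurable_segmentWeight d).comp (measurable_id.prodMk measurable_const)
        rw [← lintegral_mul_const _ (by fun_prop)]
        refine setLIntegral_congr_fun measurableSet_Ioc fun t ht ↦ ?_
        have ht0 : 0 < t := ht.1
        simp only [hΦ]
        rw [ENNReal.ofReal_mul (by positivity), mul_assoc]
    _ ≤ ∫⁻ z, ENNReal.ofReal (d ^ (n + 1) * (‖z - x‖ ^ (n - 1))⁻¹) * G z := by
        gcongr with z
        exact lintegral_segmentWeight_le Module.finrank_pos hd0 (norm_nonneg _)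
    _ = _ := by
        rw [← lintegral_indicator hDm]
        refine lintegral_congr fun z ↦ ?_
        by_cases hz : z ∈ D <;> simp [hG, hz, ENNReal.ofReal_mul (pow_nonneg hd0 _)]

theorem setLIntegral_setLIntegral_sq_sub_le [Nontrivial E] {D A B : Set E} (hDm : MeasurableSet D)
    (hD : Convex ℝ D) (hA : MeasurableSet A) (hAD : A ⊆ D) (hAfin : volume A ≠ ∞)
    (hB : MeasurableSet B) (hBD : B ⊆ D) {d : ℝ} (hd : ∀ x ∈ D, ∀ y ∈ D, ‖y - x‖ ≤ d)
    {u : E → ℝ} (hu : ContDiff ℝ 1 u) :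
    ∫⁻ x in A, ∫⁻ y in B, ENNReal.ofReal ((u x - u y) ^ 2) ≤
      ENNReal.ofReal (d ^ (Module.finrank ℝ E + 1)) *
        ENNReal.ofReal ((Module.finrank ℝ E * volume.real (ball (0 : E) 1) + 1) *
          volume.real A ^ ((1 : ℝ) / Module.finrank ℝ E)) *
        ∫⁻ z in D, ENNReal.ofReal (‖gradient u z‖ ^ 2) := by
  have hg := hu.continuous_gradient.measurable
  set n := Module.finrank ℝ E with hn
  calc ∫⁻ x in A, ∫⁻ y in B, ENNReal.ofReal ((u x - u y) ^ 2)
      ≤ ∫⁻ x in A, ∫⁻ z in D, ENNReal.ofReal (d ^ (n + 1)) *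
          ENNReal.ofReal ((‖z - x‖ ^ (n - 1))⁻¹) * ENNReal.ofReal (‖gradient u z‖ ^ 2) :=
        setLIntegral_mono' hA fun x hx ↦ setLIntegral_sq_sub_le hDm hD hB hBD hd hu (hAD hx)
    _ = ∫⁻ z in D, ∫⁻ x in A, ENNReal.ofReal (d ^ (n + 1)) *
          ENNReal.ofReal ((‖z - x‖ ^ (n - 1))⁻¹) * ENNReal.ofReal (‖gradient u z‖ ^ 2) :=
        lintegral_lintegral_swap (by fun_prop)
    _ = ∫⁻ z in D, ENNReal.ofReal (d ^ (n + 1)) *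
          (∫⁻ x in A, ENNReal.ofReal ((‖z - x‖ ^ (n - 1))⁻¹)) *
            ENNReal.ofReal (‖gradient u z‖ ^ 2) := by
        refine lintegral_congr fun z ↦ ?_
        rw [lintegral_mul_const _ (by fun_prop), lintegral_const_mul _ (by fun_prop)]
    _ ≤ ∫⁻ z in D, ENNReal.ofReal (d ^ (n + 1)) *
          ENNReal.ofReal ((n * volume.real (ball (0 : E) 1) + 1) *
            volume.real A ^ ((1 : ℝ) / n)) * ENNReal.ofReal (‖gradient u z‖ ^ 2) := by
        gcongr with z
        exact setLIntegral_inv_norm_sub_pow_le volume hAfin z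
    _ = _ := lintegral_const_mul _ (by fun_prop)

theorem measure_mul_setLIntegral_sq_le {A B : Set E} {u : E → ℝ} (hu : Continuous u) :
    volume B * ∫⁻ x in A, ENNReal.ofReal (u x ^ 2) ≤
      2 * volume A * (∫⁻ y in B, ENNReal.ofReal (u y ^ 2)) +
        2 * ∫⁻ x in A, ∫⁻ y in B, ENNReal.ofReal ((u x - u y) ^ 2) := by
  calc volume B * ∫⁻ x in A, ENNReal.ofReal (u x ^ 2)
      = ∫⁻ x in A, ∫⁻ _ in B, ENNReal.ofReal (u x ^ 2) := by
        simp_rw [setLIntegral_const]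
        rw [lintegral_mul_const _ (by fun_prop), mul_comm]
    _ ≤ ∫⁻ x in A, ∫⁻ y in B, (2 * ENNReal.ofReal (u y ^ 2) +
          2 * ENNReal.ofReal ((u x - u y) ^ 2)) := by
        refine lintegral_mono fun x ↦ lintegral_mono fun y ↦ ?_
        rw [show (2 : ℝ≥0∞) = ENNReal.ofReal 2 by simp, ← ENNReal.ofReal_mul zero_le_two,
          ← ENNReal.ofReal_mul zero_le_two, ← ENNReal.ofReal_add (by positivity) (by positivity)]
        exact ENNReal.ofReal_le_ofReal (by nlinarith [sq_nonneg (u x - 2 * u y)])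
    _ = ∫⁻ x in A, (2 * (∫⁻ y in B, ENNReal.ofReal (u y ^ 2)) +
          2 * ∫⁻ y in B, ENNReal.ofReal ((u x - u y) ^ 2)) := by
        refine lintegral_congr fun x ↦ ?_
        rw [lintegral_add_left (by fun_prop), lintegral_const_mul _ (by fun_prop),
          lintegral_const_mul _ (by fun_prop)]
    _ = _ := by
        have hm : Measurable fun x ↦ ∫⁻ y in B, ENNReal.ofReal ((u x - u y) ^ 2) :=
          Measurable.lintegral_prod_right'
            (f := fun p : E × E ↦ ENNReal.ofReal ((u p.1 - u p.2) ^ 2))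
            (by fun_prop)
        rw [lintegral_add_left measurable_const, setLIntegral_const, lintegral_const_mul _ hm]
        ring

theorem ofReal_setIntegral_eq_of_continuous {A : Set E} (hA : Bornology.IsBounded A)
    {f : E → ℝ} (hf : Continuous f) (hf0 : ∀ x, 0 ≤ f x) :
    ENNReal.ofReal (∫ x in A, f x) = ∫⁻ x in A, ENNReal.ofReal (f x) :=
  ofReal_integral_eq_lintegral_ofReal
    ((hf.continuousOn.integrableOn_compact hA.isCompact_closure).mono_set subset_closure)
    (.of_forall hf0)
end

/-- Marchenko–Khruslov lemma: for every `n ≥ 1` there is a constant `C > 0` depending only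
on `n` such that for every bounded convex open `D ⊆ ℝⁿ`, open subsets `D₁, D₂ ⊆ D` with
`vol(D₂) > 0`, and every `C¹` function `u`,
`∫_{D₁} u² ≤ (2 vol D₁ / vol D₂) ∫_{D₂} u² + C (diam D)^{n+1} (vol D₁)^{1/n} (vol D₂)⁻¹ ∫_D ‖∇u‖²`. -/
theorem marchenko_khruslov_lemma (n : ℕ) (hn : 1 ≤ n) :
    ∃ C > (0 : ℝ), ∀ D D₁ D₂ : Set (EuclideanSpace ℝ (Fin n)),
      IsOpen D → Convex ℝ D → Bornology.IsBounded D →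
      IsOpen D₁ → D₁ ⊆ D → IsOpen D₂ → D₂ ⊆ D → 0 < volume D₂ →
      ∀ u : EuclideanSpace ℝ (Fin n) → ℝ, ContDiff ℝ 1 u →
        (∫ x in D₁, (u x) ^ 2) ≤
          (2 * (volume D₁).toReal / (volume D₂).toReal) * (∫ x in D₂, (u x) ^ 2)
            + C * (diam D) ^ (n + 1) * ((volume D₁).toReal ^ ((1 : ℝ) / n))
              / (volume D₂).toReal * (∫ x in D, ‖gradient u x‖ ^ 2) := by
  set κ : ℝ := n * volume.real (ball (0 : EuclideanSpace ℝ (Fin n)) 1) + 1 with hκ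
  have hκ0 : 0 < κ := by positivity
  refine ⟨2 * κ, by positivity, ?_⟩
  intro D D₁ D₂ hDo hDc hDb hD₁o hD₁D hD₂o hD₂D hD₂pos u hu
  have : NeZero n := ⟨by omega⟩
  have hg := hu.continuous_gradient
  have hb₁ := hDb.subset hD₁D
  have hb₂ := hDb.subset hD₂D
  have hv₁ : volume D₁ ≠ ∞ := hb₁.measure_lt_top.ne
  have hv₂ : volume D₂ ≠ ∞ := hb₂.measure_lt_top.ne
  have hd : ∀ x ∈ D, ∀ y ∈ D, ‖y - x‖ ≤ diam D := fun x hx y hy ↦ by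
    rw [← dist_eq_norm]; exact dist_le_diam_of_mem hDb hy hx
  have hdouble := setLIntegral_setLIntegral_sq_sub_le hDo.measurableSet hDc hD₁o.measurableSet
    hD₁D hv₁ hD₂o.measurableSet hD₂D hd hu
  have hmain := (measure_mul_setLIntegral_sq_le (A := D₁) (B := D₂) hu.continuous).trans
    (add_le_add_right (mul_le_mul_right hdouble 2) _)
  rw [finrank_euclideanSpace_fin, ← hκ,
    ← ofReal_setIntegral_eq_of_continuous hb₁ (f := fun x ↦ u x ^ 2) (by fun_prop)
      fun _ ↦ sq_nonneg _,
    ← ofReal_setIntegral_eq_of_continuous hb₂ (f := fun x ↦ u x ^ 2) (by fun_prop)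
      fun _ ↦ sq_nonneg _,
    ← ofReal_setIntegral_eq_of_continuous hDb (f := fun x ↦ ‖gradient u x‖ ^ 2) (by fun_prop)
      fun _ ↦ sq_nonneg _,
    ← ofReal_measureReal hv₁, ← ofReal_measureReal hv₂] at hmain
  have htwo (a : ℝ) : 2 * ENNReal.ofReal a = ENNReal.ofReal (2 * a) := by
    rw [ENNReal.ofReal_mul zero_le_two, ENNReal.ofReal_ofNat]
  have hI₁ : 0 ≤ ∫ x in D₁, u x ^ 2 := integral_nonneg fun _ ↦ sq_nonneg _
  have hI₂ : 0 ≤ ∫ x in D₂, u x ^ 2 := integral_nonneg fun _ ↦ sq_nonneg _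
  have hI : 0 ≤ ∫ x in D, ‖gradient u x‖ ^ 2 := integral_nonneg fun _ ↦ sq_nonneg _
  have hdiam : 0 ≤ diam D := diam_nonneg
  have hD₂pos' : 0 < volume.real D₂ := ENNReal.toReal_pos hD₂pos.ne' hv₂
  simp only [← measureReal_def]
  rw [htwo, ← ENNReal.ofReal_mul (by positivity), ← ENNReal.ofReal_mul (by positivity),
    ← ENNReal.ofReal_mul (by positivity), ← ENNReal.ofReal_mul (by positivity), htwo,
    ← ENNReal.ofReal_add (by positivity) (by positivity),
    ENNReal.ofReal_le_ofReal_iff (by positivity)] at hmain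
  rw [mul_comm, ← le_div_iff₀ hD₂pos'] at hmain
  refine hmain.trans_eq ?_
  field_simp
end

section
/- Let n ≥ 2 be an integer, let 0 < d ≤ r ≤ R be real numbers, and let f : ℝ → ℝ be continuously differentiable on [d, R]. Then f(d)² ≤ 2·f(r)² + 2·(∫_d^R τ^{1−n} dτ)·(∫_d^R f′(τ)² τ^{n−1} dτ). Moreover, if in addition R ≤ 1, then ∫_d^R τ^{1−n} dτ ≤ d^{2−n}/(n−2) when n ≥ 3, and ∫_d^R τ^{−1} dτ ≤ |log d| when n = 2. -/
open MeasureTheory Set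

/-- Weighted Cauchy–Schwarz inequality on an interval, for a positive weight `w`. -/
theorem sq_integral_le_integral_inv_mul_integral_sq_mul {a b : ℝ} (hab : a ≤ b) {u w : ℝ → ℝ}
    (hw : ∀ x ∈ Icc a b, 0 < w x)
    (hw_inv : IntervalIntegrable (fun x => (w x)⁻¹) volume a b)
    (hu : IntervalIntegrable u volume a b)
    (huw : IntervalIntegrable (fun x => u x ^ 2 * w x) volume a b) :
    (∫ x in a..b, u x) ^ 2 ≤ (∫ x in a..b, (w x)⁻¹) * ∫ x in a..b, u x ^ 2 * w x := by
  have hquad : ∀ t : ℝ, 0 ≤ (∫ x in a..b, (w x)⁻¹) * (t * t) + (2 * ∫ x in a..b, u x) * t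
      + ∫ x in a..b, u x ^ 2 * w x := by
    intro t
    have hsum : (∫ x in a..b, (w x)⁻¹) * (t * t) + (2 * ∫ x in a..b, u x) * t
        + ∫ x in a..b, u x ^ 2 * w x
        = ∫ x in a..b, ((t * t) * (w x)⁻¹ + (2 * t) * u x + u x ^ 2 * w x) := by
      rw [intervalIntegral.integral_add ((hw_inv.const_mul _).add (hu.const_mul _)) huw,
        intervalIntegral.integral_add (hw_inv.const_mul _) (hu.const_mul _),
        intervalIntegral.integral_const_mul, intervalIntegral.integral_const_mul]
      ring
    rw [hsum]
    refine intervalIntegral.integral_nonneg hab fun x hx => ?_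
    have hx0 := hw x hx
    have hsq : (t * t) * (w x)⁻¹ + (2 * t) * u x + u x ^ 2 * w x
        = (w x)⁻¹ * (t + u x * w x) ^ 2 := by
      field_simp
      ring
    rw [hsq]
    positivity
  have hdiscrim := discrim_le_zero hquad
  rw [discrim] at hdiscrim
  linarith

/-- The increment of a `C¹` function is controlled by a weighted Dirichlet integral over any larger
interval with the same left endpoint. -/
theorem sq_sub_le_integral_inv_mul_integral_deriv_sq_mul {a r b : ℝ} (har : a ≤ r) (hrb : r ≤ b)
    {f w : ℝ → ℝ} (hf : ContDiffOn ℝ 1 f (Icc a b)) (hw : ∀ x ∈ Icc a b, 0 < w x)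
    (hwc : ContinuousOn w (Icc a b)) :
    (f r - f a) ^ 2 ≤ (∫ x in a..b, (w x)⁻¹) * ∫ x in a..b, deriv f x ^ 2 * w x := by
  have hab := har.trans hrb
  rcases hab.eq_or_lt with rfl | hlt
  · obtain rfl : a = r := le_antisymm har hrb
    simp
  have hg : ContinuousOn (derivWithin f (Icc a b)) (Icc a b) :=
    hf.continuousOn_derivWithin (uniqueDiffOn_Icc hlt) le_rfl
  have hderiv : ∀ x ∈ Ioo a b, derivWithin f (Icc a b) x = deriv f x := fun x hx =>
    derivWithin_of_mem_nhds (Icc_mem_nhds hx.1 hx.2)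
  have hint : IntervalIntegrable (deriv f) volume a b :=
    (hg.intervalIntegrable_of_Icc hab).congr_uIoo fun x hx =>
      hderiv x (by rwa [uIoo_of_le hab] at hx)
  have hint_sq : IntervalIntegrable (fun x => |deriv f x| ^ 2 * w x) volume a b :=
    (((hg.pow 2).mul hwc).intervalIntegrable_of_Icc hab).congr_uIoo fun x hx => by
      simp [hderiv x (by rwa [uIoo_of_le hab] at hx)]
  have hle : |f r - f a| ≤ ∫ x in a..b, |deriv f x| := by
    rw [← intervalIntegral.integral_deriv_of_contDiffOn_Icc (hf.mono (Icc_subset_Icc_right hrb)) har]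
    exact (intervalIntegral.abs_integral_le_integral_abs har).trans
      (intervalIntegral.integral_mono_interval le_rfl har hrb
        (Filter.Eventually.of_forall fun x => abs_nonneg _) hint.abs)
  have hcs := sq_integral_le_integral_inv_mul_integral_sq_mul hab hw
    ((hwc.inv₀ fun x hx => (hw x hx).ne').intervalIntegrable_of_Icc hab) hint.abs hint_sq
  simp only [sq_abs] at hcs
  rw [← sq_abs]
  exact (pow_le_pow_left₀ (abs_nonneg _) hle 2).trans hcs

/-- One-dimensional radial estimate: for `n ≥ 2`, `0 < d ≤ r ≤ R` and `f` continuously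
differentiable on `[d, R]`,
`f(d)² ≤ 2 f(r)² + 2 (∫_d^R τ^{1-n} dτ) (∫_d^R f'(τ)² τ^{n-1} dτ)`;
moreover, if `R ≤ 1`, then `∫_d^R τ^{1-n} dτ ≤ d^{2-n}/(n-2)` when `n ≥ 3`, and
`∫_d^R τ^{-1} dτ ≤ |log d|` when `n = 2`. -/
theorem radial_estimate (n : ℕ) (hn : 2 ≤ n) (d r R : ℝ)
    (hd : 0 < d) (hdr : d ≤ r) (hrR : r ≤ R)
    (f : ℝ → ℝ) (hf : ContDiffOn ℝ 1 f (Set.Icc d R)) :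
    (f d) ^ 2 ≤ 2 * (f r) ^ 2
        + 2 * (∫ τ in d..R, τ ^ ((1 : ℝ) - n)) * (∫ τ in d..R, (deriv f τ) ^ 2 * τ ^ ((n : ℝ) - 1))
      ∧ (R ≤ 1 →
          (3 ≤ n → (∫ τ in d..R, τ ^ ((1 : ℝ) - n)) ≤ d ^ ((2 : ℝ) - n) / ((n : ℝ) - 2))
          ∧ (n = 2 → (∫ τ in d..R, τ ^ (-1 : ℝ)) ≤ |Real.log d|)) := by
  have hdR : d ≤ R := hdr.trans hrR
  have hzero : (0 : ℝ) ∉ uIcc d R := by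
    rw [uIcc_of_le hdR]
    exact fun h => hd.not_ge h.1
  refine ⟨?_, fun hR => ⟨fun hn3 => ?_, fun _ => ?_⟩⟩
  · have hkey := sq_sub_le_integral_inv_mul_integral_deriv_sq_mul hdr hrR hf
      (w := fun τ => τ ^ ((n : ℝ) - 1))
      (fun x hx => Real.rpow_pos_of_pos (hd.trans_le hx.1) _)
      (continuousOn_id.rpow_const fun x hx => Or.inl (hd.trans_le hx.1).ne')
    have hinv : ∫ τ in d..R, (τ ^ ((n : ℝ) - 1))⁻¹ = ∫ τ in d..R, τ ^ ((1 : ℝ) - n) := by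
      refine intervalIntegral.integral_congr fun x hx => ?_
      rw [uIcc_of_le hdR] at hx
      rw [← Real.rpow_neg (hd.le.trans hx.1), neg_sub]
    rw [hinv] at hkey
    nlinarith [sq_nonneg (2 * f r - f d)]
  · have hn3' : (3 : ℝ) ≤ n := by exact_mod_cast hn3
    rw [integral_rpow (Or.inr ⟨by linarith, hzero⟩),
      show (1 : ℝ) - n + 1 = 2 - n by ring, ← neg_div_neg_eq, neg_sub, neg_sub]
    gcongr
    · linarith
    · linarith [Real.rpow_nonneg (hd.le.trans hdR) ((2 : ℝ) - n)]
  · simp only [Real.rpow_neg_one]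
    rw [integral_inv_of_pos hd (hd.trans_le hdR), Real.log_div (hd.trans_le hdR).ne' hd.ne']
    linarith [Real.log_nonpos (hd.le.trans hdR) hR, neg_abs_le (Real.log d)]
end

section
/- Let n ≥ 2 be an integer. There exists a constant C > 0, depending only on n, with the following property: for every x₀ ∈ ℝⁿ, all real numbers d, ρ with 0 < 2d ≤ ρ ≤ 1/2, and every continuously differentiable function u : ℝⁿ → ℝ, setting A := {x ∈ ℝⁿ : d ≤ |x − x₀| ≤ ρ}, one has ∫_{S(x₀,d)} u² dH^{n−1} ≤ C·( d^{n−1} ρ^{−n} ∫_A u² dx + d·ζ_d ∫_A ‖∇u‖² dx ). -/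
open MeasureTheory Metric Set

/-- A measure which is at least `r ^ s` on small balls, up to a constant, dominates the
`s`-dimensional Hausdorff measure, up to a constant. -/
theorem hausdorffMeasure_le_smul_of_rpow_le_closedBall {X : Type*} [MetricSpace X]
    [SecondCountableTopology X] [MeasurableSpace X] [BorelSpace X] (ν : Measure X)
    [ν.OuterRegular] {s : ℝ} (hs : 0 ≤ s) {c : ENNReal} (hc : c ≠ ⊤)
    (h : ∀ x : X, ∀ r : ℝ, 0 < r → r ≤ 1 → ENNReal.ofReal r ^ s ≤ c * ν (closedBall x r)) :
    (μH[s] : Measure X) ≤ (10 ^ s * c) • ν := by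
  have hc' : (10 : ENNReal) ^ s * c ≠ ⊤ :=
    ENNReal.mul_ne_top (ENNReal.rpow_ne_top_of_nonneg hs (by simp)) hc
  have hopen : ∀ U : Set X, IsOpen U → μH[s] U ≤ 10 ^ s * c * ν U := by
    intro U hU
    let t : ℕ → Set (X × ℝ) := fun k ↦
      {p | 0 < p.2 ∧ p.2 ≤ 1 / ((k : ℝ) + 1) ∧ closedBall p.1 p.2 ⊆ U}
    have hvit := fun k : ℕ ↦ Vitali.exists_disjoint_subfamily_covering_enlargement_closedBall
      (t k) Prod.fst Prod.snd (1 / ((k : ℝ) + 1)) (fun a ha ↦ ha.2.1) 5 (by norm_num)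
    choose v hvt hvd hvc using hvit
    have hcount : ∀ k, (v k).Countable := fun k ↦
      (hvd k).countable_of_nonempty_interior fun a ha ↦
        ⟨a.1, ball_subset_interior_closedBall (mem_ball_self (hvt k ha).1)⟩
    have : ∀ k, Countable (v k) := fun k ↦ (hcount k).to_subtype
    have hdiam : ∀ k (i : v k), ediam (closedBall i.1.1 (5 * i.1.2)) ≤
        10 * ENNReal.ofReal i.1.2 := by
      intro k i
      have hi := (hvt k i.2).1
      rw [← closedEBall_ofReal (by positivity)]
      refine ediam_closedEBall_le.trans_eq ?_
      rw [ENNReal.ofReal_mul (by norm_num), ← mul_assoc]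
      norm_num
    have hlim : Filter.Tendsto (fun k : ℕ ↦ 10 * ENNReal.ofReal (1 / ((k : ℝ) + 1)))
        Filter.atTop (nhds 0) := by
      have h1 := ENNReal.tendsto_ofReal tendsto_one_div_add_atTop_nhds_zero_nat
      have h2 := ENNReal.Tendsto.const_mul (a := 10) h1 (Or.inr (by simp))
      simpa using h2
    refine (Measure.hausdorffMeasure_le_liminf_tsum s U _ hlim
      (fun k (i : v k) ↦ closedBall i.1.1 (5 * i.1.2)) ?_ ?_).trans ?_
    · refine .of_forall fun k i ↦ (hdiam k i).trans ?_
      gcongr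
      exact (hvt k i.2).2.1
    · refine .of_forall fun k x hx ↦ ?_
      obtain ⟨ε, hε, hεU⟩ := Metric.nhds_basis_closedBall.mem_iff.1 (hU.mem_nhds hx)
      have hk : (0 : ℝ) < 1 / ((k : ℝ) + 1) := by positivity
      have hmem : (x, min ε (1 / ((k : ℝ) + 1))) ∈ t k :=
        ⟨lt_min hε hk, min_le_right _ _,
          (closedBall_subset_closedBall (min_le_left _ _)).trans hεU⟩
      obtain ⟨b, hb, hsub⟩ := hvc k _ hmem
      exact mem_iUnion.2 ⟨⟨b, hb⟩, hsub (mem_closedBall_self (lt_min hε hk).le)⟩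
    · refine (Filter.liminf_le_liminf (.of_forall (fun k ↦ ?_))).trans
        (Filter.liminf_const (f := (Filter.atTop : Filter ℕ)) (10 ^ s * c * ν U)).le
      calc ∑' i : v k, ediam (closedBall i.1.1 (5 * i.1.2)) ^ s
          ≤ ∑' i : v k, 10 ^ s * c * ν (closedBall i.1.1 i.1.2) := by
            refine ENNReal.tsum_le_tsum fun i ↦ ?_
            have hi := hvt k i.2
            have h1 : i.1.2 ≤ 1 := hi.2.1.trans
              ((div_le_one (by positivity)).2 (by linarith [k.cast_nonneg (α := ℝ)]))
            calc _ ≤ (10 * ENNReal.ofReal i.1.2) ^ s := by gcongr; exact hdiam k i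
              _ = 10 ^ s * ENNReal.ofReal i.1.2 ^ s := ENNReal.mul_rpow_of_nonneg _ _ hs
              _ ≤ _ := by
                rw [mul_assoc]
                gcongr
                exact h _ _ hi.1 h1
        _ = 10 ^ s * c * ν (⋃ i ∈ v k, closedBall i.1 i.2) := by
            rw [ENNReal.tsum_mul_left, measure_biUnion (hcount k) (hvd k)
              (fun i _ ↦ isClosed_closedBall.measurableSet)]
        _ ≤ 10 ^ s * c * ν U := by
            gcongr
            exact iUnion₂_subset fun i hi ↦ (hvt k hi).2.2
  have := Measure.OuterRegular.smul ν hc'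
  refine Measure.le_iff.2 fun A hA ↦ ?_
  rw [A.measure_eq_iInf_isOpen ((10 ^ s * c) • ν)]
  refine le_iInf fun U ↦ le_iInf fun hAU ↦ le_iInf fun hU ↦ ?_
  exact (measure_mono hAU).trans (by simpa using hopen U hU)

section

open scoped Pointwise

theorem ball_subset_Ioo_smul_ball_inter_sphere {E : Type*} [NormedAddCommGroup E]
    [NormedSpace ℝ E] {x : E} (hx : ‖x‖ = 1) {ε t : ℝ} (hε : ε ≤ 1)
    (ht : 1 / 2 ≤ t) (ht' : t ≤ 3 / 4) :
    ball (t • x) (ε / 8) ⊆ Ioo (0 : ℝ) 1 • (ball x ε ∩ sphere (0 : E) 1) := by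
  intro y hy
  rw [mem_ball, dist_eq_norm] at hy
  have htx : ‖t • x‖ = t := by rw [norm_smul, hx, mul_one, Real.norm_of_nonneg (by linarith)]
  have h1 : |‖y‖ - t| < ε / 8 := by
    rw [← htx]; exact (abs_norm_sub_norm_le y (t • x)).trans_lt hy
  obtain ⟨h2, h3⟩ := abs_lt.1 h1
  have hy0 : 0 < ‖y‖ := by linarith
  refine ⟨‖y‖, ⟨hy0, by linarith⟩, ‖y‖⁻¹ • y, ⟨?_, ?_⟩, ?_⟩
  · have e : ‖y‖⁻¹ • y - x = ‖y‖⁻¹ • ((y - t • x) - (‖y‖ - t) • x) := by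
      rw [sub_smul, smul_sub, smul_sub, smul_sub, smul_smul ‖y‖⁻¹ ‖y‖, inv_mul_cancel₀ hy0.ne']
      module
    have h4 : ‖(y - t • x) - (‖y‖ - t) • x‖ < ε / 4 := by
      have := norm_sub_le (y - t • x) ((‖y‖ - t) • x)
      rw [norm_smul, hx, mul_one, Real.norm_eq_abs] at this
      linarith
    rw [mem_ball, dist_eq_norm, e, norm_smul, norm_inv, norm_norm, inv_mul_lt_iff₀ hy0]
    nlinarith
  · simp [norm_smul, hy0.ne']
  · simp [smul_smul, hy0.ne']

/-- A ball of radius `ε ≤ 1` in the unit sphere of an `m`-dimensional space has measure at least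
of order `ε ^ (m - 1)`. -/
theorem pow_finrank_sub_one_le_toSphere_ball {E : Type*} [NormedAddCommGroup E] [NormedSpace ℝ E]
    [MeasurableSpace E] [BorelSpace E] [FiniteDimensional ℝ E] (μ : Measure E)
    [μ.IsAddHaarMeasure] (x : sphere (0 : E) 1) {ε : ℝ} (hε : 0 < ε) (hε1 : ε ≤ 1) :
    ENNReal.ofReal (ε ^ (Module.finrank ℝ E - 1) / (2 * 8 ^ Module.finrank ℝ E)) * μ (ball 0 1) ≤
      μ.toSphere (ball x ε) := by
  have hx : ‖(x : E)‖ = 1 := norm_eq_of_mem_sphere x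
  have : Nontrivial E := ⟨⟨x, 0, ne_of_apply_ne Norm.norm (by simp)⟩⟩
  set m := Module.finrank ℝ E with hm
  have hm0 : 0 < m := Module.finrank_pos
  rw [μ.toSphere_apply' measurableSet_ball, Subtype.image_ball]
  set N := ⌊1 / ε⌋₊ with hN
  have hNle : (N : ℝ) * ε ≤ 1 := by
    have := Nat.floor_le (show 0 ≤ 1 / ε by positivity)
    rwa [le_div_iff₀ hε] at this
  have hNge : 1 ≤ 2 * (N : ℝ) * ε := by
    have h1 := Nat.lt_floor_add_one (1 / ε)
    rw [← hN, div_lt_iff₀ hε] at h1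
    have h2 : 1 ≤ N := Nat.le_floor (by rw [le_div_iff₀ hε]; simpa using hε1)
    have h3 : (1 : ℝ) ≤ N := by exact_mod_cast h2
    nlinarith
  let p : ℕ → E := fun j ↦ (1 / 2 + j * (ε / 4)) • (x : E)
  have hsub : (⋃ j ∈ Finset.range N, ball (p j) (ε / 8)) ⊆
      Ioo (0 : ℝ) 1 • (ball (x : E) ε ∩ sphere (0 : E) 1) := by
    refine iUnion₂_subset fun j hj ↦ ball_subset_Ioo_smul_ball_inter_sphere hx hε1 ?_ ?_
    · have : 0 ≤ (j : ℝ) * (ε / 4) := by positivity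
      linarith
    · have : (j : ℝ) ≤ N := by exact_mod_cast (Finset.mem_range.1 hj).le
      nlinarith
  have hdisj : (Finset.range N : Set ℕ).PairwiseDisjoint fun j ↦ ball (p j) (ε / 8) := by
    intro i _ j _ hij
    refine ball_disjoint_ball ?_
    have h1 : (1 : ℝ) ≤ |(i : ℝ) - j| := by
      have : (1 : ℤ) ≤ |(i : ℤ) - j| := Int.one_le_abs (sub_ne_zero.2 (by exact_mod_cast hij))
      exact_mod_cast this
    have h2 : p i - p j = (((i : ℝ) - j) * (ε / 4)) • (x : E) := by
      simp only [p]; module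
    rw [dist_eq_norm, h2, norm_smul, hx, mul_one, Real.norm_eq_abs, abs_mul,
      abs_of_pos (show 0 < ε / 4 by positivity)]
    nlinarith
  have hmeas : μ (⋃ j ∈ Finset.range N, ball (p j) (ε / 8)) =
      ENNReal.ofReal (N * (ε / 8) ^ m) * μ (ball 0 1) := by
    rw [measure_biUnion_finset hdisj fun _ _ ↦ measurableSet_ball]
    simp only [μ.addHaar_ball_of_pos _ (show 0 < ε / 8 by positivity), Finset.sum_const,
      Finset.card_range, nsmul_eq_mul]
    rw [ENNReal.ofReal_mul (by positivity), ENNReal.ofReal_natCast, mul_assoc]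
  calc _ ≤ ENNReal.ofReal (N * (ε / 8) ^ m) * μ (ball 0 1) := by
        gcongr
        rw [div_pow, div_le_iff₀ (by positivity)]
        have : ε ^ m = ε ^ (m - 1) * ε := by rw [← pow_succ, Nat.sub_add_cancel hm0]
        rw [this]
        have h8 : (N : ℝ) * (ε ^ (m - 1) * ε / 8 ^ m) * (2 * 8 ^ m) =
          ε ^ (m - 1) * (2 * N * ε) := by field_simp
        rw [h8]
        exact le_mul_of_one_le_right (by positivity) hNge
    _ ≤ μ (Ioo (0 : ℝ) 1 • (ball (x : E) ε ∩ sphere (0 : E) 1)) := hmeas ▸ measure_mono hsub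
    _ ≤ _ := le_mul_of_one_le_left (by simp) (by exact_mod_cast hm0)

end

/-- On the unit sphere of an `m`-dimensional space, the `(m - 1)`-dimensional Hausdorff measure is
bounded by a multiple of the surface measure. -/
theorem exists_hausdorffMeasure_le_smul_toSphere {E : Type*} [NormedAddCommGroup E]
    [NormedSpace ℝ E] [MeasurableSpace E] [BorelSpace E] [FiniteDimensional ℝ E] [Nontrivial E]
    (μ : Measure E) [μ.IsAddHaarMeasure] :
    ∃ K : ENNReal, K ≠ ⊤ ∧
      (μH[(Module.finrank ℝ E : ℝ) - 1] : Measure (sphere (0 : E) 1)) ≤ K • μ.toSphere := by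
  set m := Module.finrank ℝ E with hm
  have hm0 : 0 < m := Module.finrank_pos
  have hs : (m : ℝ) - 1 = ((m - 1 : ℕ) : ℝ) := by rw [Nat.cast_sub hm0, Nat.cast_one]
  set b : ENNReal := ENNReal.ofReal (1 / (2 * 8 ^ m)) * μ (ball 0 1) with hb
  have hb0 : b ≠ 0 := mul_ne_zero (by simp) (measure_ball_pos μ 0 one_pos).ne'
  have hbt : b ≠ ⊤ := ENNReal.mul_ne_top ENNReal.ofReal_ne_top measure_ball_lt_top.ne
  have : SecondCountableTopology E := secondCountable_of_proper
  refine ⟨10 ^ ((m : ℝ) - 1) * b⁻¹, ?_, ?_⟩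
  · refine ENNReal.mul_ne_top (ENNReal.rpow_ne_top_of_nonneg ?_ (by simp)) (by simpa using hb0)
    rw [hs]; positivity
  · refine hausdorffMeasure_le_smul_of_rpow_le_closedBall μ.toSphere (by rw [hs]; positivity)
      (by simpa using hb0) fun x r hr hr1 ↦ ?_
    rw [hs, ENNReal.rpow_natCast, ← ENNReal.ofReal_pow hr.le, mul_comm, ← div_eq_mul_inv,
      ENNReal.le_div_iff_mul_le (.inl hb0) (.inl hbt)]
    refine le_trans (le_of_eq ?_) ((pow_finrank_sub_one_le_toSphere_ball μ x hr hr1).trans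
      (measure_mono ball_subset_closedBall))
    rw [hb, ← mul_assoc, ← ENNReal.ofReal_mul (by positivity), ← hm]
    congr 2
    ring

theorem hausdorffMeasure_restrict_sphere_le {E : Type*} [NormedAddCommGroup E]
    [NormedSpace ℝ E] [MeasurableSpace E] [BorelSpace E] {s : ℝ} (hs : 0 ≤ s) (x₀ : E) {d : ℝ}
    (hd : 0 < d) :
    (μH[s] : Measure E).restrict (sphere x₀ d) ≤ ENNReal.ofReal (d ^ s) •
      (μH[s] : Measure (sphere (0 : E) 1)).map fun ω : sphere (0 : E) 1 ↦ x₀ + d • (ω : E) := by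
  have hlip : LipschitzWith d.toNNReal fun ω : sphere (0 : E) 1 ↦ x₀ + d • (ω : E) := by
    refine LipschitzWith.of_dist_le_mul fun ω η ↦ ?_
    rw [dist_add_left, dist_smul₀, Real.norm_of_nonneg hd.le, Real.coe_toNNReal _ hd.le,
      Subtype.dist_eq]
  refine Measure.le_iff.2 fun A hA ↦ ?_
  rw [Measure.restrict_apply hA, Measure.smul_apply,
    Measure.map_apply hlip.continuous.measurable hA, smul_eq_mul]
  have hsub : A ∩ sphere x₀ d ⊆ (fun ω : sphere (0 : E) 1 ↦ x₀ + d • (ω : E)) ''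
      ((fun ω : sphere (0 : E) 1 ↦ x₀ + d • (ω : E)) ⁻¹' A) := by
    rintro y ⟨hyA, hy⟩
    rw [mem_sphere, dist_eq_norm] at hy
    have hy' : x₀ + d • (d⁻¹ • (y - x₀)) = y := by simp [smul_smul, hd.ne']
    exact ⟨⟨d⁻¹ • (y - x₀), by simp [norm_smul, hy, abs_of_pos hd, hd.ne']⟩,
      by simpa [hy'] using hyA, hy'⟩
  refine (measure_mono hsub).trans ((hlip.hausdorffMeasure_image_le hs _).trans_eq ?_)
  rw [← ENNReal.ofReal_rpow_of_pos hd]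
  rfl

/-- The integral of a nonnegative continuous function over a sphere of radius `d` with respect to
the Hausdorff measure is bounded by a multiple of `d ^ (m - 1)` times the integral of its pullback
to the unit sphere with respect to the surface measure. -/
theorem exists_integral_sphere_hausdorffMeasure_le {E : Type*} [NormedAddCommGroup E]
    [NormedSpace ℝ E] [MeasurableSpace E] [BorelSpace E] [FiniteDimensional ℝ E] [Nontrivial E]
    (μ : Measure E) [μ.IsAddHaarMeasure] :
    ∃ K : ℝ, 0 ≤ K ∧ ∀ (x₀ : E) (d : ℝ), 0 < d → ∀ f : E → ℝ, Continuous f → (∀ x, 0 ≤ f x) →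
      ∫ x in sphere x₀ d, f x ∂(μH[(Module.finrank ℝ E : ℝ) - 1]) ≤
        K * ∫ ω : sphere (0 : E) 1,
          d ^ (Module.finrank ℝ E - 1) * f (x₀ + d • (ω : E)) ∂μ.toSphere := by
  obtain ⟨K, hK, hle⟩ := exists_hausdorffMeasure_le_smul_toSphere μ
  set m := Module.finrank ℝ E with hm
  have hm0 : 0 < m := Module.finrank_pos
  have hs : (m : ℝ) - 1 = ((m - 1 : ℕ) : ℝ) := by rw [Nat.cast_sub hm0, Nat.cast_one]
  refine ⟨K.toReal, ENNReal.toReal_nonneg, fun x₀ d hd f hf hf0 ↦ ?_⟩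
  have hφ : Continuous fun ω : sphere (0 : E) 1 ↦ x₀ + d • (ω : E) := by fun_prop
  set c := ENNReal.ofReal (d ^ ((m : ℝ) - 1)) with hc
  have hmeas : (μH[(m : ℝ) - 1] : Measure E).restrict (sphere x₀ d) ≤
      (c * K) • μ.toSphere.map fun ω : sphere (0 : E) 1 ↦ x₀ + d • (ω : E) := by
    refine (hausdorffMeasure_restrict_sphere_le (by rw [hs]; positivity) x₀ hd).trans ?_
    rw [mul_smul, ← Measure.map_smul (μ := μ.toSphere)]
    refine Measure.le_iff.2 fun A hA ↦ ?_
    simp only [Measure.smul_apply, smul_eq_mul]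
    gcongr
    exact hφ.measurable
  have hint : Integrable (fun ω : sphere (0 : E) 1 ↦ f (x₀ + d • (ω : E))) μ.toSphere :=
    (hf.comp hφ).integrable_of_hasCompactSupport (HasCompactSupport.of_compactSpace _)
  have hint' : Integrable f (μ.toSphere.map fun ω : sphere (0 : E) 1 ↦ x₀ + d • (ω : E)) :=
    (integrable_map_measure hf.aestronglyMeasurable hφ.aemeasurable).2 hint
  calc _ ≤ ∫ x, f x ∂((c * K) • μ.toSphere.map fun ω : sphere (0 : E) 1 ↦ x₀ + d • (ω : E)) :=
        integral_mono_measure hmeas (.of_forall hf0)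
          (hint'.smul_measure (ENNReal.mul_ne_top ENNReal.ofReal_ne_top hK))
    _ = _ := by
        rw [integral_smul_measure, integral_map hφ.aemeasurable hf.aestronglyMeasurable,
          integral_const_mul, ENNReal.toReal_mul, hc, ENNReal.toReal_ofReal (by positivity), hs,
          Real.rpow_natCast, smul_eq_mul]
        ring

/-- Integration in polar coordinates over a spherical shell centred at `x₀`. -/
theorem integrable_and_integral_shell_eq {E : Type*} [NormedAddCommGroup E] [NormedSpace ℝ E]
    [MeasurableSpace E] [BorelSpace E] [FiniteDimensional ℝ E] [Nontrivial E] (μ : Measure E)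
    [μ.IsAddHaarMeasure] {f : E → ℝ} (hf : Continuous f) (x₀ : E) {a b : ℝ} (ha : 0 < a)
    (hab : a ≤ b) :
    Integrable (fun ω : sphere (0 : E) 1 ↦
      ∫ r in a..b, r ^ (Module.finrank ℝ E - 1) * f (x₀ + r • (ω : E))) μ.toSphere ∧
    ∫ x in closedBall x₀ b \ ball x₀ a, f x ∂μ =
      ∫ ω : sphere (0 : E) 1, (∫ r in a..b,
        r ^ (Module.finrank ℝ E - 1) * f (x₀ + r • (ω : E))) ∂μ.toSphere := by
  set m := Module.finrank ℝ E - 1 with hm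
  set A : Set E := closedBall x₀ b \ ball x₀ a with hA
  have hAm : MeasurableSet A := measurableSet_closedBall.diff measurableSet_ball
  let F : E → ℝ := fun y ↦ A.indicator f (x₀ + y)
  have hFint : Integrable F μ := by
    have h1 : Integrable (A.indicator f) μ := by
      rw [integrable_indicator_iff hAm]
      exact (hf.continuousOn.integrableOn_compact
        ((isCompact_closedBall x₀ b).diff isOpen_ball))
    exact h1.comp_add_left x₀
  have hFeq : ∫ x in A, f x ∂μ = ∫ y, F y ∂μ := by
    rw [← integral_indicator hAm]
    exact (integral_add_left_eq_self (A.indicator f) x₀).symm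
  have hmp := μ.measurePreserving_homeomorphUnitSphereProd
  have hemb := Homeomorph.measurableEmbedding (homeomorphUnitSphereProd E)
  let G : sphere (0 : E) 1 × Ioi (0 : ℝ) → ℝ := fun p ↦ F (p.2.1 • p.1.1)
  have hG : ∀ x : ({0}ᶜ : Set E), G (homeomorphUnitSphereProd E x) = F x := by
    intro x
    have hx : ‖(x : E)‖ ≠ 0 := norm_ne_zero_iff.2 x.2
    simp [G, smul_smul, hx]
  have hGint : Integrable G (μ.toSphere.prod (Measure.volumeIoiPow m)) := by
    rw [← hmp.integrable_comp_emb hemb]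
    have : G ∘ homeomorphUnitSphereProd E = fun x : ({0}ᶜ : Set E) ↦ F x := funext hG
    rw [this]
    exact (integrableOn_iff_comap_subtypeVal (measurableSet_singleton _).compl).1
      hFint.integrableOn
  have hGeq : ∫ y, F y ∂μ = ∫ p, G p ∂(μ.toSphere.prod (Measure.volumeIoiPow m)) := by
    have h0 : ∫ y, F y ∂μ = ∫ y in {0}ᶜ, F y ∂μ := by rw [restrict_compl_singleton]
    rw [← hmp.integral_comp hemb, h0,
      ← integral_subtype_comap (measurableSet_singleton _).compl]
    exact integral_congr_ae (.of_forall fun x ↦ (hG x).symm)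
  have hinner : ∀ ω : sphere (0 : E) 1, ∫ r, G (ω, r) ∂(Measure.volumeIoiPow m) =
      ∫ r in a..b, r ^ m * f (x₀ + r • (ω : E)) := by
    intro ω
    have hω : ‖(ω : E)‖ = 1 := norm_eq_of_mem_sphere ω
    simp only [Measure.volumeIoiPow, ENNReal.ofReal]
    rw [integral_withDensity_eq_integral_smul
        (measurable_subtype_coe.pow_const _).real_toNNReal,
      integral_subtype_comap measurableSet_Ioi
        fun r : ℝ ↦ Real.toNNReal (r ^ m) • F (r • (ω : E)),
      intervalIntegral.integral_of_le hab, ← integral_Icc_eq_integral_Ioc,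
      ← integral_indicator measurableSet_Ioi, ← integral_indicator measurableSet_Icc]
    congr 1
    ext r
    by_cases hr : 0 < r
    · have hmem : x₀ + r • (ω : E) ∈ A ↔ r ∈ Icc a b := by
        simp [hA, norm_smul, hω, abs_of_pos hr, and_comm]
      rw [indicator_of_mem (show r ∈ Ioi (0 : ℝ) from hr), NNReal.smul_def,
        Real.coe_toNNReal _ (by positivity)]
      by_cases h : r ∈ Icc a b
      · simp [F, h, hmem.2 h]
      · simp only [F, indicator_of_notMem h, indicator_of_notMem (mt hmem.1 h), smul_zero]
    · rw [indicator_of_notMem (show r ∉ Ioi (0 : ℝ) from hr), indicator_of_notMem]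
      exact fun h ↦ hr (ha.trans_le h.1)
  refine ⟨?_, ?_⟩
  · simpa only [hinner] using hGint.integral_prod_left
  · rw [hFeq, hGeq, integral_prod _ hGint]
    simp only [hinner]

theorem sq_integral_le_integral_inv_mul_integral_sq_mul_s2 {f p : ℝ → ℝ} {a b : ℝ} (hab : a < b)
    (hf : ContinuousOn f (Icc a b)) (hp : ContinuousOn p (Icc a b))
    (hpos : ∀ r ∈ Icc a b, 0 < p r) :
    (∫ r in a..b, f r) ^ 2 ≤ (∫ r in a..b, (p r)⁻¹) * ∫ r in a..b, p r * f r ^ 2 := by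
  have hinv : ContinuousOn (fun r ↦ (p r)⁻¹) (Icc a b) := hp.inv₀ fun r hr ↦ (hpos r hr).ne'
  have hI : ∀ {g : ℝ → ℝ}, ContinuousOn g (Icc a b) → IntervalIntegrable g volume a b :=
    fun hg ↦ hg.intervalIntegrable_of_Icc hab.le
  set P := ∫ r in a..b, (p r)⁻¹
  set J := ∫ r in a..b, f r
  set Q := ∫ r in a..b, p r * f r ^ 2
  have hP : 0 < P := intervalIntegral.intervalIntegral_pos_of_pos_on (hI hinv)
    (fun r hr ↦ inv_pos.2 (hpos r (Ioo_subset_Icc_self hr))) hab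
  have hnn : 0 ≤ ∫ r in a..b, (P ^ 2 * (p r * f r ^ 2) - 2 * P * J * f r + J ^ 2 * (p r)⁻¹) := by
    refine intervalIntegral.integral_nonneg hab.le fun r hr ↦ ?_
    have := hpos r hr
    have e : P ^ 2 * (p r * f r ^ 2) - 2 * P * J * f r + J ^ 2 * (p r)⁻¹ =
        (P * (p r * f r) - J) ^ 2 * (p r)⁻¹ := by field_simp; ring
    rw [e]; positivity
  have h1 : IntervalIntegrable (fun r ↦ P ^ 2 * (p r * f r ^ 2)) volume a b :=
    (hI (hp.mul (hf.pow 2))).const_mul _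
  have h2 : IntervalIntegrable (fun r ↦ 2 * P * J * f r) volume a b := (hI hf).const_mul _
  have h3 : IntervalIntegrable (fun r ↦ J ^ 2 * (p r)⁻¹) volume a b := (hI hinv).const_mul _
  rw [intervalIntegral.integral_add (h1.sub h2) h3, intervalIntegral.integral_sub h1 h2] at hnn
  simp only [intervalIntegral.integral_const_mul] at hnn
  change 0 ≤ P ^ 2 * Q - 2 * P * J * J + J ^ 2 * P at hnn
  have : 0 ≤ P * (P * Q - J ^ 2) := by linarith
  linarith [nonneg_of_mul_nonneg_right this hP]

theorem pow_mul_integral_inv_pow_le {n : ℕ} (hn : 2 ≤ n) {d s : ℝ} (hd : 0 < d) (hds : d ≤ s)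
    (hs : s ≤ 1) :
    d ^ (n - 1) * ∫ r in d..s, (r ^ (n - 1))⁻¹ ≤ d * if n = 2 then |Real.log d| else 1 := by
  have hs0 : 0 < s := hd.trans_le hds
  have h0 : (0 : ℝ) ∉ uIcc d s := by
    rw [uIcc_of_le hds]; exact fun h ↦ absurd h.1 (not_le.2 hd)
  split_ifs with h
  · subst h
    simp only [Nat.add_one_sub_one, pow_one]
    rw [integral_inv_of_pos hd hs0, Real.log_div hs0.ne' hd.ne',
      abs_of_nonpos (Real.log_nonpos hd.le (hds.trans hs))]
    have := Real.log_nonpos hs0.le hs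
    gcongr
    linarith
  · obtain ⟨k, rfl⟩ : ∃ k, n = k + 3 := ⟨n - 3, by omega⟩
    have hint : ∫ r in d..s, d ^ 2 * (-(-(r ^ 2)⁻¹)) = d ^ 2 * (-(s⁻¹ - d⁻¹)) := by
      rw [intervalIntegral.integral_const_mul, intervalIntegral.integral_neg]
      congr 2
      refine intervalIntegral.integral_eq_sub_of_hasDerivAt (f := fun r : ℝ ↦ r⁻¹)
        (fun r hr ↦ hasDerivAt_inv (ne_of_mem_of_not_mem hr h0)) ?_
      refine ContinuousOn.intervalIntegrable ?_
      exact ((continuousOn_pow 2).inv₀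
        fun r hr ↦ pow_ne_zero 2 (ne_of_mem_of_not_mem hr h0)).neg
    rw [← intervalIntegral.integral_const_mul]
    calc _ ≤ ∫ r in d..s, d ^ 2 * (-(-(r ^ 2)⁻¹)) := by
          refine intervalIntegral.integral_mono_on hds ?_ ?_ fun r hr ↦ ?_
          · refine ContinuousOn.intervalIntegrable (continuousOn_const.mul ?_)
            exact ((continuousOn_pow _).inv₀
              fun r hr ↦ pow_ne_zero _ (ne_of_mem_of_not_mem hr h0))
          · refine ContinuousOn.intervalIntegrable (continuousOn_const.mul ?_)
            exact ((continuousOn_pow _).inv₀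
              fun r hr ↦ pow_ne_zero _ (ne_of_mem_of_not_mem hr h0)).neg.neg
          · have hr0 : 0 < r := hd.trans_le hr.1
            have hk : d ^ k ≤ r ^ k := pow_le_pow_left₀ hd.le hr.1 k
            rw [neg_neg, show k + 3 - 1 = k + 2 by omega, pow_add, pow_add, mul_inv]
            calc d ^ k * d ^ 2 * ((r ^ k)⁻¹ * (r ^ 2)⁻¹)
                = (d ^ k * (r ^ k)⁻¹) * (d ^ 2 * (r ^ 2)⁻¹) := by ring
              _ ≤ 1 * (d ^ 2 * (r ^ 2)⁻¹) := by
                gcongr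
                rw [← div_eq_mul_inv]
                exact div_le_one_of_le₀ hk (by positivity)
              _ = _ := one_mul _
      _ = d - d ^ 2 * s⁻¹ := by rw [hint]; field_simp; ring
      _ ≤ d * 1 := by
          have : 0 ≤ d ^ 2 * s⁻¹ := by positivity
          linarith

/-- One-dimensional weighted trace estimate at the left endpoint. -/
theorem pow_mul_sq_le_integral_add_integral_deriv {n : ℕ} (hn : 2 ≤ n) {d ρ : ℝ} (hd : 0 < d)
    (hdρ : 2 * d ≤ ρ) (hρ : ρ ≤ 1) {w w' : ℝ → ℝ} (hw : ∀ r, HasDerivAt w (w' r) r)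
    (hw' : Continuous w') :
    d ^ (n - 1) * w d ^ 2 ≤
      4 * n * (d ^ (n - 1) / ρ ^ n) * (∫ r in d..ρ, r ^ (n - 1) * w r ^ 2) +
      2 * (d * if n = 2 then |Real.log d| else 1) * ∫ r in d..ρ, r ^ (n - 1) * w' r ^ 2 := by
  have hρ0 : 0 < ρ := by linarith
  have hle : d ≤ ρ := by linarith
  have hwc : Continuous w := continuous_iff_continuousAt.2 fun r ↦ (hw r).continuousAt
  set Z := d * if n = 2 then |Real.log d| else 1 with hZ
  have hZ0 : 0 ≤ Z := by positivity
  set I₂ := ∫ r in d..ρ, r ^ (n - 1) * w' r ^ 2 with hI₂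
  have hI₂0 : 0 ≤ I₂ := intervalIntegral.integral_nonneg hle fun r hr ↦ by
    have : 0 < r := hd.trans_le hr.1
    positivity
  have key : ∀ s ∈ Icc d ρ, d ^ (n - 1) * w d ^ 2 ≤ 2 * d ^ (n - 1) * w s ^ 2 + 2 * Z * I₂ := by
    intro s hs
    have hJ : d ^ (n - 1) * (w s - w d) ^ 2 ≤ Z * I₂ := by
      rcases hs.1.eq_or_lt with rfl | hlt
      · simpa using mul_nonneg hZ0 hI₂0
      have hcs := sq_integral_le_integral_inv_mul_integral_sq_mul_s2 (p := fun r ↦ r ^ (n - 1)) hlt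
        hw'.continuousOn (continuousOn_pow _) fun r hr ↦ pow_pos (hd.trans_le hr.1) _
      rw [intervalIntegral.integral_eq_sub_of_hasDerivAt (fun r _ ↦ hw r)
        (hw'.intervalIntegrable _ _)] at hcs
      have hmono : ∫ r in d..s, r ^ (n - 1) * w' r ^ 2 ≤ I₂ := by
        refine intervalIntegral.integral_mono_interval le_rfl hs.1 hs.2 ?_
          (Continuous.intervalIntegrable (by fun_prop) _ _)
        filter_upwards [ae_restrict_mem measurableSet_Ioc] with r hr
        have : 0 < r := hd.trans hr.1
        simp only [Pi.zero_apply]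
        positivity
      have hnn : 0 ≤ ∫ r in d..s, r ^ (n - 1) * w' r ^ 2 :=
        intervalIntegral.integral_nonneg hs.1 fun r hr ↦ by
          have : 0 < r := hd.trans_le hr.1
          positivity
      calc _ ≤ d ^ (n - 1) * ((∫ r in d..s, (r ^ (n - 1))⁻¹) *
            ∫ r in d..s, r ^ (n - 1) * w' r ^ 2) := by gcongr
        _ = (d ^ (n - 1) * ∫ r in d..s, (r ^ (n - 1))⁻¹) *
            ∫ r in d..s, r ^ (n - 1) * w' r ^ 2 := by ring
        _ ≤ Z * I₂ := by
          gcongr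
          exact pow_mul_integral_inv_pow_le hn hd hs.1 (hs.2.trans hρ)
    have hsq : w d ^ 2 ≤ 2 * w s ^ 2 + 2 * (w s - w d) ^ 2 := by
      linarith [sq_nonneg (2 * w s - w d)]
    have := mul_le_mul_of_nonneg_left hsq (show 0 ≤ d ^ (n - 1) by positivity)
    linarith
  set I₁ := ∫ r in d..ρ, r ^ (n - 1) * w r ^ 2 with hI₁
  have hI₁0 : 0 ≤ I₁ := intervalIntegral.integral_nonneg hle fun r hr ↦ by
    have : 0 < r := hd.trans_le hr.1
    positivity
  set M := ∫ s in d..ρ, s ^ (n - 1) with hM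
  have hn0 : (0 : ℝ) < n := by exact_mod_cast (by omega : 0 < n)
  have hMge : ρ ^ n / (2 * n) ≤ M := by
    have h1 : M = (ρ ^ n - d ^ n) / n := by
      rw [hM, integral_pow, Nat.sub_add_cancel (by omega), Nat.cast_sub (by omega)]
      simp
    have h2 : 2 * d ^ n ≤ ρ ^ n := by
      calc 2 * d ^ n ≤ 2 ^ n * d ^ n := by
            gcongr
            exact le_self_pow₀ (by norm_num) (by omega)
        _ = (2 * d) ^ n := (mul_pow _ _ _).symm
        _ ≤ ρ ^ n := by gcongr
    rw [h1, div_le_div_iff₀ (by positivity) hn0]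
    nlinarith
  have hM0 : 0 < M := lt_of_lt_of_le (by positivity) hMge
  have hint : d ^ (n - 1) * w d ^ 2 * M ≤ 2 * d ^ (n - 1) * I₁ + 2 * Z * I₂ * M := by
    rw [hM, hI₁, ← intervalIntegral.integral_const_mul, ← intervalIntegral.integral_const_mul,
      ← intervalIntegral.integral_const_mul, ← intervalIntegral.integral_add
      (Continuous.intervalIntegrable (by fun_prop) _ _)
      (Continuous.intervalIntegrable (by fun_prop) _ _)]
    refine intervalIntegral.integral_mono_on hle
      (Continuous.intervalIntegrable (by fun_prop) _ _)
      (Continuous.intervalIntegrable (by fun_prop) _ _) fun s hs ↦ ?_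
    have := mul_le_mul_of_nonneg_right (key s hs)
      (show 0 ≤ s ^ (n - 1) from pow_nonneg (hd.le.trans hs.1) _)
    linarith
  have h1 : d ^ (n - 1) * w d ^ 2 ≤ 2 * d ^ (n - 1) * I₁ / M + 2 * Z * I₂ := by
    rw [← sub_le_iff_le_add, le_div_iff₀ hM0]
    linarith
  have h2 : 2 * d ^ (n - 1) * I₁ / M ≤ 4 * n * (d ^ (n - 1) / ρ ^ n) * I₁ := by
    calc _ ≤ 2 * d ^ (n - 1) * I₁ / (ρ ^ n / (2 * n)) := by gcongr
      _ = _ := by field_simp; ring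
  linarith

/-- Boundary-layer trace estimate on a sphere: for `n ≥ 2` there is `C > 0` depending only
on `n` such that for all `x₀ ∈ ℝⁿ`, `0 < 2d ≤ ρ ≤ 1/2` and every `C¹` function `u`, with
`A = {x : d ≤ |x - x₀| ≤ ρ}`,
`∫_{S(x₀,d)} u² dH^{n-1} ≤ C (d^{n-1} ρ^{-n} ∫_A u² + d ζ_d ∫_A ‖∇u‖²)`,
where `ζ_d = 1` for `n ≥ 3` and `ζ_d = |log d|` for `n = 2`. -/
theorem sphere_trace_estimate (n : ℕ) (hn : 2 ≤ n) :
    ∃ C > (0 : ℝ), ∀ (x₀ : EuclideanSpace ℝ (Fin n)) (d ρ : ℝ),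
      0 < d → 2 * d ≤ ρ → ρ ≤ 1 / 2 →
      ∀ u : EuclideanSpace ℝ (Fin n) → ℝ, ContDiff ℝ 1 u →
        (∫ x in sphere x₀ d, (u x) ^ 2 ∂(μH[(n : ℝ) - 1])) ≤
          C * (d ^ (n - 1) / ρ ^ n * (∫ x in closedBall x₀ ρ \ ball x₀ d, (u x) ^ 2)
            + d * (if n = 2 then |Real.log d| else 1)
              * (∫ x in closedBall x₀ ρ \ ball x₀ d, ‖gradient u x‖ ^ 2)) := by
  have : Nontrivial (EuclideanSpace ℝ (Fin n)) := by
    have : Nonempty (Fin n) := ⟨⟨0, by omega⟩⟩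
    infer_instance
  obtain ⟨K, hK, hsphere⟩ :=
    exists_integral_sphere_hausdorffMeasure_le (volume : Measure (EuclideanSpace ℝ (Fin n)))
  rw [finrank_euclideanSpace_fin] at hsphere
  refine ⟨K * (4 * n) + 1, by positivity, fun x₀ d ρ hd hdρ hρ u hu ↦ ?_⟩
  have hle : d ≤ ρ := by linarith
  have hρ0 : 0 < ρ := by linarith
  have hfd : Continuous (fderiv ℝ u) := hu.continuous_fderiv one_ne_zero
  have hgn : ∀ x, ‖gradient u x‖ = ‖fderiv ℝ u x‖ := fun x ↦ by simp [gradient]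
  simp only [hgn]
  have hu2 : Continuous fun x ↦ u x ^ 2 := hu.continuous.pow 2
  have hg2 : Continuous fun x ↦ ‖fderiv ℝ u x‖ ^ 2 := hfd.norm.pow 2
  obtain ⟨hi₁, he₁⟩ := integrable_and_integral_shell_eq volume hu2 x₀ hd hle
  obtain ⟨hi₂, he₂⟩ := integrable_and_integral_shell_eq volume hg2 x₀ hd hle
  rw [finrank_euclideanSpace_fin] at hi₁ he₁ hi₂ he₂
  set I₁ := ∫ x in closedBall x₀ ρ \ ball x₀ d, u x ^ 2 with hI₁
  set I₂ := ∫ x in closedBall x₀ ρ \ ball x₀ d, ‖fderiv ℝ u x‖ ^ 2 with hI₂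
  have hI₁0 : 0 ≤ I₁ := integral_nonneg fun x ↦ by positivity
  have hI₂0 : 0 ≤ I₂ := integral_nonneg fun x ↦ by positivity
  set Z := d * (if n = 2 then |Real.log d| else 1) with hZ
  have hZ0 : 0 ≤ Z := by positivity
  have hray : ∀ ω : sphere (0 : EuclideanSpace ℝ (Fin n)) 1,
      d ^ (n - 1) * u (x₀ + d • (ω : EuclideanSpace ℝ (Fin n))) ^ 2 ≤
        4 * n * (d ^ (n - 1) / ρ ^ n) *
          (∫ r in d..ρ, r ^ (n - 1) * u (x₀ + r • (ω : EuclideanSpace ℝ (Fin n))) ^ 2) +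
        2 * Z * ∫ r in d..ρ,
          r ^ (n - 1) * ‖fderiv ℝ u (x₀ + r • (ω : EuclideanSpace ℝ (Fin n)))‖ ^ 2 := by
    intro ω
    have hω : ‖(ω : EuclideanSpace ℝ (Fin n))‖ = 1 := norm_eq_of_mem_sphere ω
    have hderiv : ∀ r : ℝ, HasDerivAt (fun r : ℝ ↦ u (x₀ + r • (ω : EuclideanSpace ℝ (Fin n))))
        (fderiv ℝ u (x₀ + r • (ω : EuclideanSpace ℝ (Fin n))) ω) r := fun r ↦ by
      have h1 := ((hasDerivAt_id r).smul_const (ω : EuclideanSpace ℝ (Fin n))).const_add x₀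
      rw [one_smul] at h1
      exact ((hu.differentiable one_ne_zero) _).hasFDerivAt.comp_hasDerivAt r h1
    have hray' : Continuous fun r : ℝ ↦ x₀ + r • (ω : EuclideanSpace ℝ (Fin n)) := by fun_prop
    have hcont : Continuous fun r : ℝ ↦
        fderiv ℝ u (x₀ + r • (ω : EuclideanSpace ℝ (Fin n))) ω :=
      (hfd.comp hray').clm_apply continuous_const
    refine (pow_mul_sq_le_integral_add_integral_deriv hn hd hdρ (by linarith) hderiv
      hcont).trans ?_
    gcongr
    refine intervalIntegral.integral_mono_on hle
      (((continuous_pow _).mul (hcont.pow 2)).intervalIntegrable _ _)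
      (((continuous_pow _).mul (hg2.comp hray')).intervalIntegrable _ _) fun r hr ↦ ?_
    have hr0 : 0 < r := hd.trans_le hr.1
    refine mul_le_mul_of_nonneg_left ?_ (by positivity)
    rw [← sq_abs, ← Real.norm_eq_abs]
    gcongr
    simpa [hω] using (fderiv ℝ u (x₀ + r • (ω : EuclideanSpace ℝ (Fin n)))).le_opNorm ω
  have hint : Integrable (fun ω : sphere (0 : EuclideanSpace ℝ (Fin n)) 1 ↦
      d ^ (n - 1) * u (x₀ + d • (ω : EuclideanSpace ℝ (Fin n))) ^ 2) volume.toSphere := by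
    refine Continuous.integrable_of_hasCompactSupport ?_ (HasCompactSupport.of_compactSpace _)
    have := hu.continuous
    fun_prop
  have hmono := integral_mono hint ((hi₁.const_mul _).add (hi₂.const_mul _)) hray
  rw [integral_add' (hi₁.const_mul _) (hi₂.const_mul _),
    integral_const_mul (4 * n * (d ^ (n - 1) / ρ ^ n)), integral_const_mul (2 * Z),
    ← he₁, ← he₂] at hmono
  have hn2 : (2 : ℝ) ≤ 4 * n := by
    have : (2 : ℝ) ≤ n := by exact_mod_cast hn
    linarith
  calc _ ≤ K * _ := hsphere x₀ d hd _ hu2 fun x ↦ by positivity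
    _ ≤ K * (4 * n * (d ^ (n - 1) / ρ ^ n) * I₁ + 2 * Z * I₂) := by gcongr
    _ ≤ K * (4 * n * (d ^ (n - 1) / ρ ^ n) * I₁ + 4 * n * Z * I₂) := by gcongr
    _ = K * (4 * n) * (d ^ (n - 1) / ρ ^ n * I₁ + Z * I₂) := by ring
    _ ≤ _ := by
        gcongr
        linarith
end

section
/- Let n ≥ 2 be an integer. There exists a constant C > 0, depending only on n, with the following property: for every x₀ ∈ ℝⁿ, all real numbers d, ρ with 0 < 2d ≤ ρ ≤ 1/2, and every continuously differentiable function u : ℝⁿ → ℝ, setting A := {x ∈ ℝⁿ : d ≤ |x − x₀| ≤ ρ}, one has ∫_A u² dx ≤ C·( ρⁿ d^{1−n} ∫_{S(x₀,d)} u² dH^{n−1} + ρⁿ d^{2−n} ζ_d ∫_A ‖∇u‖² dx ). -/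
open MeasureTheory Metric Set
open scoped ENNReal Topology

/-- Weighted one-dimensional estimate along a ray. -/
lemma sq_le_two_mul_sq_add_integral {g p : ℝ → ℝ} {a b I : ℝ} (hg : ContDiff ℝ 1 g)
    (hp : Continuous p) (hp0 : ∀ t ∈ Icc a b, 0 < p t) (hI : 0 < I)
    (hpI : ∫ t in a..b, (p t)⁻¹ ≤ I) {r : ℝ} (hr : r ∈ Icc a b) :
    g r ^ 2 ≤ 2 * g a ^ 2 + 2 * I * ∫ t in a..b, p t * deriv g t ^ 2 := by
  have hab : a ≤ b := hr.1.trans hr.2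
  have hg' : Continuous (deriv g) := hg.continuous_deriv le_rfl
  have hpi : ContinuousOn (fun t ↦ (p t)⁻¹) (uIcc a b) := by
    rw [uIcc_of_le hab]
    exact hp.continuousOn.inv₀ fun t ht ↦ (hp0 t ht).ne'
  set J := ∫ t in a..b, p t * deriv g t ^ 2
  have key : ∀ c : ℝ, 2 * c * (g r - g a) ≤ c ^ 2 * I + J := by
    intro c
    have hi1 : IntervalIntegrable (fun t ↦ c ^ 2 * (p t)⁻¹) volume a b :=
      (hpi.intervalIntegrable).const_mul _
    have hi2 : IntervalIntegrable (fun t ↦ p t * deriv g t ^ 2) volume a b :=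
      (hp.mul (hg'.pow 2)).intervalIntegrable _ _
    have hsub : uIcc a r ⊆ uIcc a b := by
      rw [uIcc_of_le hab, uIcc_of_le hr.1]
      exact Icc_subset_Icc_right hr.2
    have hsum := hi1.add hi2
    have hnn : ∀ t ∈ Icc a b, 0 ≤ c ^ 2 * (p t)⁻¹ + p t * deriv g t ^ 2 := fun t ht ↦ by
      have := hp0 t ht
      positivity
    calc 2 * c * (g r - g a) = ∫ t in a..r, 2 * c * deriv g t := by
          rw [intervalIntegral.integral_const_mul, intervalIntegral.integral_deriv_eq_sub
            (fun x _ ↦ (hg.differentiable one_ne_zero) x) (hg'.intervalIntegrable _ _)]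
      _ ≤ ∫ t in a..r, (c ^ 2 * (p t)⁻¹ + p t * deriv g t ^ 2) := by
          refine intervalIntegral.integral_mono_on hr.1
            ((hg'.intervalIntegrable _ _).const_mul _) (hsum.mono_set hsub) fun t ht ↦ ?_
          have h0 := hp0 t ⟨ht.1, ht.2.trans hr.2⟩
          have : c ^ 2 * (p t)⁻¹ + p t * deriv g t ^ 2 - 2 * c * deriv g t
              = p t * (c * (p t)⁻¹ - deriv g t) ^ 2 := by field_simp; ring
          nlinarith [mul_nonneg h0.le (sq_nonneg (c * (p t)⁻¹ - deriv g t))]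
      _ ≤ ∫ t in a..b, (c ^ 2 * (p t)⁻¹ + p t * deriv g t ^ 2) := by
          refine intervalIntegral.integral_mono_interval le_rfl hr.1 hr.2 ?_ hsum
          filter_upwards [ae_restrict_mem measurableSet_Ioc] with t ht
          exact hnn t ⟨ht.1.le, ht.2⟩
      _ = c ^ 2 * (∫ t in a..b, (p t)⁻¹) + J := by
          rw [intervalIntegral.integral_add hi1 hi2, intervalIntegral.integral_const_mul]
      _ ≤ c ^ 2 * I + J := by gcongr
  have h1 : (g r - g a) ^ 2 ≤ I * J := by
    have h := key ((g r - g a) / I)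
    have h2 : 2 * ((g r - g a) / I) * (g r - g a) = 2 * ((g r - g a) ^ 2 / I) := by ring
    have h3 : ((g r - g a) / I) ^ 2 * I = (g r - g a) ^ 2 / I := by field_simp
    rw [h2, h3] at h
    have h4 : (g r - g a) ^ 2 / I ≤ J := by linarith
    rw [div_le_iff₀ hI] at h4
    linarith
  nlinarith [sq_nonneg (g r - 2 * g a)]

/-- Bound for the radial weight, with the logarithm in dimension two. -/
lemma integral_inv_pow_le {n : ℕ} (hn : 2 ≤ n) {d ρ : ℝ} (hd : 0 < d) (hdρ : d ≤ ρ)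
    (hρ : ρ ≤ 1) :
    ∫ t in d..ρ, (t ^ (n - 1))⁻¹ ≤
      d ^ ((2 : ℝ) - n) * (if n = 2 then |Real.log d| else 1) := by
  have h0 : (0 : ℝ) ∉ uIcc d ρ := by
    rw [uIcc_of_le hdρ]
    exact fun h ↦ absurd h.1 (not_le.2 hd)
  split_ifs with h
  · subst h
    have : ∫ t in d..ρ, (t ^ (2 - 1))⁻¹ = Real.log (ρ / d) := by
      simpa using integral_inv h0
    rw [this, Real.log_div (by linarith) hd.ne',
      abs_of_nonpos (Real.log_nonpos hd.le (by linarith))]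
    have := Real.log_nonpos (hd.le.trans hdρ) hρ
    norm_num
    linarith
  · have hn3 : (3 : ℝ) ≤ n := by exact_mod_cast (by omega : 3 ≤ n)
    have e : ∫ t in d..ρ, (t ^ (n - 1))⁻¹ = ∫ t in d..ρ, t ^ ((1 : ℝ) - n) := by
      refine intervalIntegral.integral_congr fun t ht ↦ ?_
      rw [uIcc_of_le hdρ] at ht
      have ht0 : 0 < t := hd.trans_le ht.1
      have : ((1 : ℝ) - n) = -((n - 1 : ℕ) : ℝ) := by
        rw [Nat.cast_sub (by omega)]; simp
      simp only [this, Real.rpow_neg ht0.le, Real.rpow_natCast]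
    rw [e, integral_rpow (Or.inr ⟨by linarith, h0⟩), mul_one]
    have e2 : (1 : ℝ) - n + 1 = 2 - n := by ring
    rw [e2]
    have h1 : 0 ≤ ρ ^ ((2 : ℝ) - n) := Real.rpow_nonneg (by linarith) _
    have h2 : 0 ≤ d ^ ((2 : ℝ) - n) := Real.rpow_nonneg (by linarith) _
    rw [div_le_iff_of_neg (by linarith)]
    nlinarith

section NormedSpace

open scoped Pointwise

variable {E : Type*} [NormedAddCommGroup E] [NormedSpace ℝ E] [FiniteDimensional ℝ E]
    [MeasurableSpace E] [BorelSpace E]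

open Module in
/-- A cap of radius `r` in the unit sphere has measure of order at most `r ^ (dim E - 1)`. -/
lemma toSphere_le_of_subset_closedBall [Nontrivial E] (μ : Measure E) [μ.IsAddHaarMeasure]
    {s : Set (sphere (0 : E) 1)}
    (hs : MeasurableSet s) (ω : sphere (0 : E) 1) {r : ℝ} (hr : 0 < r) (hr1 : r ≤ 1)
    (hsr : s ⊆ closedBall ω r) :
    μ.toSphere s ≤ ENNReal.ofReal (finrank ℝ E * 2 ^ (finrank ℝ E + 1) * μ.real (ball 0 1) *
      r ^ (finrank ℝ E - 1)) := by
  have hdim : 0 < finrank ℝ E := finrank_pos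
  rw [μ.toSphere_apply' hs]
  have hsub : Ioo (0 : ℝ) 1 • ((↑) '' s : Set E) ⊆
      ⋃ k ∈ Finset.range ⌈1 / r⌉₊, closedBall ((k * r) • (ω : E)) (2 * r) := by
    rintro _ ⟨t, ht, _, ⟨y, hy, rfl⟩, rfl⟩
    have htr : 0 ≤ t / r := div_nonneg ht.1.le hr.le
    have h1 : (⌊t / r⌋₊ : ℝ) * r ≤ t := by
      rw [← le_div_iff₀ hr]; exact Nat.floor_le htr
    have h2 : t < (⌊t / r⌋₊ + 1 : ℝ) * r := by
      rw [← div_lt_iff₀ hr]; exact Nat.lt_floor_add_one _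
    simp only [mem_iUnion, Finset.mem_range, mem_closedBall, dist_eq_norm]
    refine ⟨⌊t / r⌋₊, ?_, ?_⟩
    · rw [Nat.lt_ceil]
      refine (Nat.floor_le htr).trans_lt ?_
      gcongr
      exact ht.2
    · have e : t • (y : E) - ((⌊t / r⌋₊ : ℝ) * r) • (ω : E)
          = t • ((y : E) - ω) + (t - ⌊t / r⌋₊ * r) • (ω : E) := by module
      have hy' : ‖(y : E) - ω‖ ≤ r := by
        have := hsr hy
        rwa [mem_closedBall, Subtype.dist_eq, dist_eq_norm] at this
      have hω : ‖(ω : E)‖ = 1 := norm_eq_of_mem_sphere ω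
      rw [e]
      refine (norm_add_le _ _).trans ?_
      rw [norm_smul, norm_smul, hω, Real.norm_of_nonneg ht.1.le,
        Real.norm_of_nonneg (sub_nonneg.2 h1)]
      nlinarith [ht.1, ht.2, norm_nonneg ((y : E) - ω)]
  have hN : (⌈1 / r⌉₊ : ℝ) ≤ 2 / r := by
    have h1 : 1 ≤ 1 / r := by rw [le_div_iff₀ hr]; linarith
    have h2 := Nat.ceil_lt_add_one (by positivity : 0 ≤ 1 / r)
    have : 2 / r = 1 / r + 1 / r := by ring
    linarith
  have hμ : μ (Ioo (0 : ℝ) 1 • ((↑) '' s : Set E)) ≤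
      ENNReal.ofReal (⌈1 / r⌉₊ * ((2 * r) ^ finrank ℝ E * μ.real (ball 0 1))) := by
    calc _ ≤ _ := measure_mono hsub
      _ ≤ _ := measure_biUnion_finset_le _ _
      _ = _ := by
        have hb : μ (ball 0 1) ≠ ∞ := measure_ball_lt_top.ne
        simp only [μ.addHaar_closedBall _ (by positivity : 0 ≤ 2 * r), Finset.sum_const,
          Finset.card_range, nsmul_eq_mul]
        rw [ENNReal.ofReal_mul (by positivity), ENNReal.ofReal_mul (by positivity),
          ENNReal.ofReal_natCast, ofReal_measureReal hb]
  calc _ ≤ _ := mul_le_mul_right hμ _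
    _ = ENNReal.ofReal (finrank ℝ E *
          (⌈1 / r⌉₊ * ((2 * r) ^ finrank ℝ E * μ.real (ball 0 1)))) := by
        rw [ENNReal.ofReal_mul (Nat.cast_nonneg _) (p := (finrank ℝ E : ℝ)),
          ENNReal.ofReal_natCast]
    _ ≤ _ := by
        refine ENNReal.ofReal_le_ofReal ?_
        have e : (2 : ℝ) / r * (2 * r) ^ finrank ℝ E =
            2 ^ (finrank ℝ E + 1) * r ^ (finrank ℝ E - 1) := by
          obtain ⟨m, hm⟩ : ∃ m, finrank ℝ E = m + 1 := ⟨_, (Nat.succ_pred_eq_of_pos hdim).symm⟩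
          rw [hm, Nat.add_sub_cancel]
          field_simp
          ring
        calc _ ≤ finrank ℝ E * (2 / r * ((2 * r) ^ finrank ℝ E * μ.real (ball 0 1))) := by gcongr
          _ = finrank ℝ E * (2 / r * (2 * r) ^ finrank ℝ E) * μ.real (ball 0 1) := by ring
          _ = _ := by rw [e]; ring

/-- Integration in polar coordinates. -/
lemma lintegral_eq_lintegral_toSphere [Nontrivial E] (μ : Measure E) [μ.IsAddHaarMeasure]
    {f : E → ℝ≥0∞} (hf : Measurable f) :
    ∫⁻ x, f x ∂μ = ∫⁻ ω : sphere (0 : E) 1, (∫⁻ t in Ioi (0 : ℝ),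
      ENNReal.ofReal (t ^ (Module.finrank ℝ E - 1)) * f (t • (ω : E))) ∂μ.toSphere := by
  have hm : MeasurableSet ({(0 : E)}ᶜ) := (measurableSet_singleton _).compl
  have h1 : ∫⁻ x, f x ∂μ = ∫⁻ x : ({(0)}ᶜ : Set E), f x ∂(μ.comap (↑)) := by
    rw [lintegral_subtype_comap hm, restrict_compl_singleton]
  have h2 := μ.measurePreserving_homeomorphUnitSphereProd.lintegral_comp_emb
    (Homeomorph.measurableEmbedding _)
    (fun q : sphere (0 : E) 1 × Ioi (0 : ℝ) ↦ f (q.2.1 • (q.1 : E)))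
  have hms : Measurable fun q : sphere (0 : E) 1 × Ioi (0 : ℝ) ↦ f (q.2.1 • (q.1 : E)) :=
    hf.comp (by fun_prop)
  have h3 : ∀ x : ({(0)}ᶜ : Set E), f ((homeomorphUnitSphereProd E x).2.1 •
      ((homeomorphUnitSphereProd E x).1 : E)) = f x := by
    intro x
    congr 1
    exact congrArg Subtype.val ((homeomorphUnitSphereProd E).symm_apply_apply x)
  simp only [h3] at h2
  rw [h1, h2, lintegral_prod _ hms.aemeasurable]
  refine lintegral_congr fun ω ↦ ?_
  rw [Measure.volumeIoiPow, lintegral_withDensity_eq_lintegral_mul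
    (g := fun t : Ioi (0 : ℝ) ↦ f (t.1 • (ω : E))) _
    (by fun_prop) (hms.comp measurable_prodMk_left)]
  exact lintegral_subtype_comap measurableSet_Ioi
    (fun t : ℝ ↦ ENNReal.ofReal (t ^ (Module.finrank ℝ E - 1)) * f (t • (ω : E)))

/-- Polar coordinates on an annulus. -/
lemma setLIntegral_annulus_eq [Nontrivial E] (μ : Measure E) [μ.IsAddHaarMeasure]
    {f : E → ℝ≥0∞} (hf : Measurable f) (x₀ : E) {d ρ : ℝ} (hd : 0 < d) :
    ∫⁻ x in closedBall x₀ ρ \ ball x₀ d, f x ∂μ = ∫⁻ ω : sphere (0 : E) 1,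
      (∫⁻ t in Icc d ρ, ENNReal.ofReal (t ^ (Module.finrank ℝ E - 1)) *
        f (x₀ + t • (ω : E))) ∂μ.toSphere := by
  have hA : MeasurableSet (closedBall x₀ ρ \ ball x₀ d) :=
    measurableSet_closedBall.diff measurableSet_ball
  rw [← lintegral_indicator hA, ← lintegral_add_left_eq_self _ x₀,
    lintegral_eq_lintegral_toSphere μ
      (f := fun x ↦ (closedBall x₀ ρ \ ball x₀ d).indicator f (x₀ + x))
      ((hf.indicator hA).comp (measurable_const_add x₀))]
  refine lintegral_congr fun ω ↦ ?_
  rw [← lintegral_indicator measurableSet_Ioi, ← lintegral_indicator measurableSet_Icc]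
  refine lintegral_congr fun t ↦ ?_
  have hω : ‖(ω : E)‖ = 1 := norm_eq_of_mem_sphere ω
  by_cases ht : 0 < t
  · have hiff : x₀ + t • (ω : E) ∈ closedBall x₀ ρ \ ball x₀ d ↔ t ∈ Icc d ρ := by
      simp [dist_eq_norm, norm_smul, hω, abs_of_pos ht, and_comm]
    by_cases h : t ∈ Icc d ρ
    · simp [ht, h, indicator_of_mem (hiff.2 h)]
    · simp [ht, h, indicator_of_notMem (hiff.not.2 h)]
  · have h : t ∉ Icc d ρ := fun h ↦ ht (hd.trans_le h.1)
    rw [indicator_of_notMem h, indicator_of_notMem (by simpa using ht)]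

open Module in
/-- The surface measure `toSphere`, transported to a sphere of radius `d`, is controlled by the
Hausdorff measure of codimension one. -/
lemma map_toSphere_le_hausdorffMeasure (hdim : 2 ≤ finrank ℝ E) (μ : Measure E)
    [μ.IsAddHaarMeasure] (x₀ : E) {d : ℝ} (hd : 0 < d) :
    μ.toSphere.map (fun ω : sphere (0 : E) 1 ↦ x₀ + d • (ω : E)) ≤
      ENNReal.ofReal (finrank ℝ E * 2 ^ (finrank ℝ E + 1) * μ.real (ball 0 1) *
        d ^ ((1 : ℝ) - finrank ℝ E)) • μH[(finrank ℝ E : ℝ) - 1] := by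
  have : Nontrivial E := nontrivial_of_finrank_pos (R := ℝ) (by omega)
  set N := finrank ℝ E
  set K : ℝ := N * 2 ^ (N + 1) * μ.real (ball 0 1)
  set φ : sphere (0 : E) 1 → E := fun ω ↦ x₀ + d • (ω : E)
  have hφ : Continuous φ := by fun_prop
  have hNr : ((N : ℝ) - 1) = ((N - 1 : ℕ) : ℝ) := by
    rw [Nat.cast_sub (by omega)]; simp
  have hdist : ∀ ω ω', dist (φ ω) (φ ω') = d * dist ω ω' := fun ω ω' ↦ by
    simp [φ, dist_smul₀, abs_of_pos hd, Subtype.dist_eq]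
  have hK : 0 < K := by
    have hb : 0 < μ.real (ball (0 : E) 1) :=
      ENNReal.toReal_pos (measure_ball_pos μ 0 one_pos).ne' measure_ball_lt_top.ne
    have : (0 : ℝ) < N := by exact_mod_cast (by omega : 0 < N)
    positivity
  have hKd : 0 < K * d ^ ((1 : ℝ) - N) := mul_pos hK (Real.rpow_pos_of_pos hd _)
  have hκ0 : ENNReal.ofReal (K * d ^ ((1 : ℝ) - N)) ≠ 0 := by simpa using hKd
  have hκt : ENNReal.ofReal (K * d ^ ((1 : ℝ) - N)) ≠ ∞ := ENNReal.ofReal_ne_top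
  have hcap : ∀ (s : Set E) (r : ℝ), 0 < r → r ≤ 1 → ediam s ≤ ENNReal.ofReal (d * r) →
      μ.toSphere.map φ s ≤ ENNReal.ofReal (K * r ^ (N - 1)) := by
    intro s r hr hr1 hsr
    refine (measure_mono subset_closure).trans ?_
    rw [Measure.map_apply hφ.measurable isClosed_closure.measurableSet]
    rcases (φ ⁻¹' closure s).eq_empty_or_nonempty with h | ⟨ω, hω⟩
    · simp [h]
    · refine toSphere_le_of_subset_closedBall μ
        (hφ.measurable isClosed_closure.measurableSet) ω hr hr1 fun ω' hω' ↦ ?_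
      have h1 : edist (φ ω') (φ ω) ≤ ENNReal.ofReal (d * r) :=
        (edist_le_ediam_of_mem (s := closure s) hω' hω).trans ((ediam_closure s).trans_le hsr)
      rw [edist_dist, hdist, ENNReal.ofReal_le_ofReal_iff (by positivity)] at h1
      exact le_of_mul_le_mul_left h1 hd
  have hmain : (ENNReal.ofReal (K * d ^ ((1 : ℝ) - N)))⁻¹ • μ.toSphere.map φ ≤
      μH[(N : ℝ) - 1] := by
    refine Measure.le_hausdorffMeasure _ _ (ENNReal.ofReal d) (by simpa using hd) fun s hs ↦ ?_
    rw [Measure.smul_apply, smul_eq_mul, mul_comm, ← div_eq_mul_inv,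
      ENNReal.div_le_iff hκ0 hκt]
    have hst : ediam s ≠ ∞ := (hs.trans_lt ENNReal.ofReal_lt_top).ne
    set δ := (ediam s).toReal
    have hδ : ediam s = ENNReal.ofReal δ := (ENNReal.ofReal_toReal hst).symm
    have hδ0 : 0 ≤ δ := ENNReal.toReal_nonneg
    have hδd : δ ≤ d := by rwa [hδ, ENNReal.ofReal_le_ofReal_iff hd.le] at hs
    rcases hδ0.eq_or_lt with h | h
    · have hlim : Filter.Tendsto (fun r : ℝ ↦ ENNReal.ofReal (K * r ^ (N - 1))) (𝓝[>] 0)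
          (𝓝 0) := by
        have hc : Continuous fun r : ℝ ↦ ENNReal.ofReal (K * r ^ (N - 1)) :=
          ENNReal.continuous_ofReal.comp (by fun_prop)
        have := hc.tendsto 0
        rw [zero_pow (by omega), mul_zero, ENNReal.ofReal_zero] at this
        exact this.mono_left nhdsWithin_le_nhds
      refine le_trans (ge_of_tendsto hlim ?_) zero_le
      filter_upwards [Ioc_mem_nhdsGT (zero_lt_one' ℝ)] with r hr
      refine hcap s r hr.1 hr.2 ?_
      rw [hδ, ← h, ENNReal.ofReal_zero]
      exact zero_le
    · refine (hcap s (δ / d) (by positivity) (by rwa [div_le_one hd]) ?_).trans_eq ?_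
      · rw [hδ, mul_div_cancel₀ _ hd.ne']
      · rw [hδ, ENNReal.ofReal_rpow_of_pos h, ← ENNReal.ofReal_mul (by positivity)]
        congr 1
        have : (1 : ℝ) - N = -((N - 1 : ℕ) : ℝ) := by rw [← hNr]; ring
        rw [this, hNr, Real.rpow_neg hd.le, Real.rpow_natCast, Real.rpow_natCast, div_pow]
        ring
  calc _ = ENNReal.ofReal (K * d ^ ((1 : ℝ) - N)) •
        ((ENNReal.ofReal (K * d ^ ((1 : ℝ) - N)))⁻¹ • μ.toSphere.map φ) := by
        rw [smul_smul, ENNReal.mul_inv_cancel hκ0 hκt, one_smul]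
    _ ≤ _ := by
        intro s
        simp only [Measure.smul_apply _ _ s, smul_eq_mul] at *
        exact mul_le_mul_right (hmain s) _

open Module in
/-- Annulus estimate with the rescaled surface measure `toSphere` on the inner sphere. -/
lemma setLIntegral_annulus_sq_le (hdim : 2 ≤ finrank ℝ E) (μ : Measure E) [μ.IsAddHaarMeasure]
    (x₀ : E) {d ρ I : ℝ} (hd : 0 < d) (hdρ : d ≤ ρ) (hI : 0 < I)
    (hdI : ∫ t in d..ρ, (t ^ (finrank ℝ E - 1))⁻¹ ≤ I) {u : E → ℝ} (hu : ContDiff ℝ 1 u) :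
    ∫⁻ x in closedBall x₀ ρ \ ball x₀ d, ENNReal.ofReal (u x ^ 2) ∂μ ≤
      ENNReal.ofReal (ρ ^ finrank ℝ E) *
        (ENNReal.ofReal 2 * ∫⁻ ω : sphere (0 : E) 1,
            ENNReal.ofReal (u (x₀ + d • (ω : E)) ^ 2) ∂μ.toSphere +
          ENNReal.ofReal (2 * I) * ∫⁻ x in closedBall x₀ ρ \ ball x₀ d,
            ENNReal.ofReal (‖fderiv ℝ u x‖ ^ 2) ∂μ) := by
  have : Nontrivial E := nontrivial_of_finrank_pos (R := ℝ) (by omega)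
  have huc : Continuous u := hu.continuous
  have hu' : Continuous (fderiv ℝ u) := hu.continuous_fderiv one_ne_zero
  have hρ : 0 < ρ := hd.trans_le hdρ
  set N := finrank ℝ E
  set B : sphere (0 : E) 1 → ℝ≥0∞ := fun ω ↦
    ENNReal.ofReal 2 * ENNReal.ofReal (u (x₀ + d • (ω : E)) ^ 2) +
      ENNReal.ofReal (2 * I) * ∫⁻ t in Icc d ρ, ENNReal.ofReal (t ^ (N - 1)) *
        ENNReal.ofReal (‖fderiv ℝ u (x₀ + t • (ω : E))‖ ^ 2)
  have hray : ∀ (ω : sphere (0 : E) 1), ∀ r ∈ Icc d ρ,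
      ENNReal.ofReal (u (x₀ + r • (ω : E)) ^ 2) ≤ B ω := by
    intro ω r hr
    have hω : ‖(ω : E)‖ = 1 := norm_eq_of_mem_sphere ω
    have hline : ContDiff ℝ 1 fun t : ℝ ↦ x₀ + t • (ω : E) := by fun_prop
    have hderiv : ∀ t, deriv (fun t : ℝ ↦ u (x₀ + t • (ω : E))) t
        = fderiv ℝ u (x₀ + t • (ω : E)) ω := fun t ↦ by
      have h1 : HasDerivAt (fun t : ℝ ↦ x₀ + t • (ω : E)) (ω : E) t := by
        simpa using ((hasDerivAt_id t).smul_const (ω : E)).const_add x₀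
      exact (((hu.differentiable one_ne_zero) _).hasFDerivAt.comp_hasDerivAt t h1).deriv
    have h1 := sq_le_two_mul_sq_add_integral (hu.comp hline) (continuous_pow (N - 1))
      (fun t ht ↦ pow_pos (hd.trans_le ht.1) _) hI hdI hr
    have hc : Continuous fun t : ℝ ↦ t ^ (N - 1) * ‖fderiv ℝ u (x₀ + t • (ω : E))‖ ^ 2 := by
      fun_prop
    have h2 : ∫ t in d..ρ, t ^ (N - 1) * deriv (u ∘ fun t : ℝ ↦ x₀ + t • (ω : E)) t ^ 2 ≤
        ∫ t in d..ρ, t ^ (N - 1) * ‖fderiv ℝ u (x₀ + t • (ω : E))‖ ^ 2 := by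
      refine intervalIntegral.integral_mono_on hdρ ?_ (hc.intervalIntegrable _ _) fun t ht ↦ ?_
      · exact ((continuous_pow _).mul
          (((hu.comp hline).continuous_deriv le_rfl).pow 2)).intervalIntegrable _ _
      · have ht0 : 0 ≤ t := hd.le.trans ht.1
        have h3 : |deriv (u ∘ fun t : ℝ ↦ x₀ + t • (ω : E)) t| ≤
            ‖fderiv ℝ u (x₀ + t • (ω : E))‖ := by
          have := (fderiv ℝ u (x₀ + t • (ω : E))).le_opNorm ω
          rw [hω, mul_one] at this
          exact (congrArg _ (hderiv t)).trans_le this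
        refine mul_le_mul_of_nonneg_left ?_ (by positivity)
        rw [← sq_abs]
        gcongr
    have h4 : ENNReal.ofReal (∫ t in d..ρ, t ^ (N - 1) * ‖fderiv ℝ u (x₀ + t • (ω : E))‖ ^ 2) =
        ∫⁻ t in Icc d ρ, ENNReal.ofReal (t ^ (N - 1)) *
          ENNReal.ofReal (‖fderiv ℝ u (x₀ + t • (ω : E))‖ ^ 2) := by
      rw [intervalIntegral.integral_of_le hdρ, ← integral_Icc_eq_integral_Ioc,
        ofReal_integral_eq_lintegral_ofReal hc.integrableOn_Icc]
      · refine setLIntegral_congr_fun measurableSet_Icc fun t ht ↦ ?_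
        exact ENNReal.ofReal_mul (pow_nonneg (hd.le.trans ht.1) _)
      · filter_upwards [ae_restrict_mem measurableSet_Icc] with t ht
        have ht0 : 0 ≤ t := hd.le.trans ht.1
        simp only [Pi.zero_apply]
        positivity
    simp only [B]
    rw [← h4, ← ENNReal.ofReal_mul zero_le_two, ← ENNReal.ofReal_mul (by positivity),
      ← ENNReal.ofReal_add (by positivity)]
    · refine ENNReal.ofReal_le_ofReal (h1.trans ?_)
      simp only [Function.comp_apply]
      gcongr
    · refine mul_nonneg (by positivity) (intervalIntegral.integral_nonneg hdρ fun t ht ↦ ?_)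
      have ht0 : 0 ≤ t := hd.le.trans ht.1
      positivity
  have hradial : ∀ ω : sphere (0 : E) 1, (∫⁻ t in Icc d ρ, ENNReal.ofReal (t ^ (N - 1)) *
      ENNReal.ofReal (u (x₀ + t • (ω : E)) ^ 2)) ≤ ENNReal.ofReal (ρ ^ N) * B ω := by
    intro ω
    calc _ ≤ ∫⁻ t in Icc d ρ, ENNReal.ofReal (ρ ^ (N - 1)) * B ω := by
          refine setLIntegral_mono measurable_const fun t ht ↦ ?_
          have ht0 : 0 ≤ t := hd.le.trans ht.1
          gcongr
          · exact ht.2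
          · exact hray ω t ht
      _ = ENNReal.ofReal (ρ ^ (N - 1) * (ρ - d)) * B ω := by
          rw [setLIntegral_const, Real.volume_Icc, ENNReal.ofReal_mul (by positivity)]
          ring
      _ ≤ _ := by
          gcongr
          have : ρ ^ N = ρ ^ (N - 1) * ρ := by rw [← pow_succ]; congr 1; omega
          rw [this]
          gcongr
          linarith
  rw [setLIntegral_annulus_eq μ (by fun_prop) x₀ hd, setLIntegral_annulus_eq μ (by fun_prop) x₀ hd]
  calc _ ≤ ∫⁻ ω, ENNReal.ofReal (ρ ^ N) * B ω ∂μ.toSphere := lintegral_mono hradial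
    _ = _ := by
      rw [lintegral_const_mul' _ _ ENNReal.ofReal_ne_top, lintegral_add_left (by fun_prop),
        lintegral_const_mul' _ _ ENNReal.ofReal_ne_top,
        lintegral_const_mul' _ _ ENNReal.ofReal_ne_top]

end NormedSpace

section InnerProductSpace

variable {F : Type*} [NormedAddCommGroup F] [InnerProductSpace ℝ F] [FiniteDimensional ℝ F]
    [MeasurableSpace F] [BorelSpace F]

open Module in
lemma hausdorffMeasure_unitSphere_lt_top (hdim : 0 < finrank ℝ F) :
    μH[(finrank ℝ F : ℝ) - 1] (sphere (0 : F) 1) < ∞ := by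
  refine (isCompact_sphere (0 : F) 1).measure_lt_top_of_nhdsWithin fun x hx ↦ ?_
  obtain ⟨m, hm⟩ : ∃ m, finrank ℝ F = m + 1 := ⟨_, (Nat.succ_pred_eq_of_pos hdim).symm⟩
  have : Fact (finrank ℝ F = m + 1) := ⟨hm⟩
  have hx0 : ‖x‖ = 1 := by simpa using hx
  have hv : ‖-x‖ = 1 := by rwa [norm_neg]
  have hfr : finrank ℝ (ℝ ∙ (-x))ᗮ = m :=
    Submodule.finrank_orthogonal_span_singleton (by rw [← norm_ne_zero_iff, hv]; exact one_ne_zero)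
  set f : (ℝ ∙ (-x))ᗮ → F := fun w ↦ stereoInvFunAux (-x) (w : F)
  have hf : ContDiff ℝ 1 f := contDiff_stereoInvFunAux.comp (ℝ ∙ (-x))ᗮ.subtypeL.contDiff
  obtain ⟨K, t, ht, hK⟩ := hf.locallyLipschitz 0
  have ht' : t ∩ ball 0 1 ∈ 𝓝 (0 : (ℝ ∙ (-x))ᗮ) := Filter.inter_mem ht (ball_mem_nhds _ one_pos)
  have hf0 : f 0 = x := by
    simp [f, stereoInvFunAux_apply, smul_smul]
  refine ⟨f '' (t ∩ ball 0 1), ?_, ?_⟩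
  · have h1 := (isOpenEmbedding_stereographic_symm hv).isOpenMap.image_mem_nhds ht'
    have h2 : ((stereographic hv).symm 0 : sphere (0 : F) 1) = ⟨x, hx⟩ := Subtype.ext hf0
    rw [h2] at h1
    have h3 := Filter.image_mem_map (m := ((↑) : sphere (0 : F) 1 → F)) h1
    rw [map_nhds_subtype_val, image_image] at h3
    exact h3
  · have hmr : ((finrank ℝ F : ℝ) - 1) = (finrank ℝ (ℝ ∙ (-x))ᗮ : ℝ) := by
      rw [hfr, hm]; simp
    rw [hmr]
    refine ((hK.mono inter_subset_left).hausdorffMeasure_image_le (Nat.cast_nonneg _)).trans_lt ?_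
    refine ENNReal.mul_lt_top (by simp) ?_
    exact (measure_mono inter_subset_right).trans_lt measure_ball_lt_top

open Module in
lemma hausdorffMeasure_sphere_lt_top (hdim : 0 < finrank ℝ F) (x : F) {r : ℝ} (hr : 0 < r) :
    μH[(finrank ℝ F : ℝ) - 1] (sphere x r) < ∞ := by
  have hsub : sphere x r ⊆ (fun y : F ↦ x + r • y) '' sphere 0 1 := by
    intro y hy
    refine ⟨r⁻¹ • (y - x), ?_, by simp [smul_smul, hr.ne']⟩
    rw [mem_sphere, dist_eq_norm] at hy
    rw [mem_sphere_zero_iff_norm, norm_smul, hy, norm_inv, Real.norm_of_nonneg hr.le,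
      inv_mul_cancel₀ hr.ne']
  have hL : LipschitzWith r.toNNReal fun y : F ↦ x + r • y :=
    LipschitzWith.of_dist_le_mul fun y z ↦ by simp [dist_smul₀, abs_of_pos hr, hr.le]
  have h0 : (0 : ℝ) ≤ finrank ℝ F - 1 := by
    rw [sub_nonneg]
    exact_mod_cast hdim
  refine (measure_mono hsub).trans_lt ((hL.hausdorffMeasure_image_le h0 _).trans_lt ?_)
  exact ENNReal.mul_lt_top (ENNReal.rpow_lt_top_of_nonneg h0 ENNReal.coe_ne_top)
    (hausdorffMeasure_unitSphere_lt_top hdim)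

end InnerProductSpace

/-- Annulus estimate by the inner sphere: for `n ≥ 2` there is `C > 0` depending only on `n`
such that for all `x₀ ∈ ℝⁿ`, `0 < 2d ≤ ρ ≤ 1/2` and every `C¹` function `u`, with
`A = {x : d ≤ |x - x₀| ≤ ρ}`,
`∫_A u² ≤ C (ρⁿ d^{1-n} ∫_{S(x₀,d)} u² dH^{n-1} + ρⁿ d^{2-n} ζ_d ∫_A ‖∇u‖²)`,
where `ζ_d = 1` for `n ≥ 3` and `ζ_d = |log d|` for `n = 2`. -/
theorem annulus_estimate (n : ℕ) (hn : 2 ≤ n) :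
    ∃ C > (0 : ℝ), ∀ (x₀ : EuclideanSpace ℝ (Fin n)) (d ρ : ℝ),
      0 < d → 2 * d ≤ ρ → ρ ≤ 1 / 2 →
      ∀ u : EuclideanSpace ℝ (Fin n) → ℝ, ContDiff ℝ 1 u →
        (∫ x in closedBall x₀ ρ \ ball x₀ d, (u x) ^ 2) ≤
          C * (ρ ^ n * d ^ ((1 : ℝ) - n) * (∫ x in sphere x₀ d, (u x) ^ 2 ∂(μH[(n : ℝ) - 1]))
            + ρ ^ n * d ^ ((2 : ℝ) - n) * (if n = 2 then |Real.log d| else 1)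
              * (∫ x in closedBall x₀ ρ \ ball x₀ d, ‖gradient u x‖ ^ 2)) := by
  set E := EuclideanSpace ℝ (Fin n)
  have hfr : Module.finrank ℝ E = n := finrank_euclideanSpace_fin
  set K : ℝ := n * 2 ^ (n + 1) * (volume : Measure E).real (ball 0 1)
  have hK : 0 ≤ K := by positivity
  refine ⟨2 * (K + 1), by positivity, fun x₀ d ρ hd hdρ hρ u hu ↦ ?_⟩
  have hdρ' : d ≤ ρ := by linarith
  have hρ0 : 0 < ρ := by linarith
  set ζ : ℝ := if n = 2 then |Real.log d| else 1
  have hζ : 0 < ζ := by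
    simp only [ζ]
    split_ifs
    · exact abs_pos.2 (Real.log_neg hd (by linarith)).ne
    · exact one_pos
  set I : ℝ := d ^ ((2 : ℝ) - n) * ζ
  have hI : 0 < I := mul_pos (Real.rpow_pos_of_pos hd _) hζ
  have hA : IsCompact (closedBall x₀ ρ \ ball x₀ d) :=
    (isCompact_closedBall x₀ ρ).diff isOpen_ball
  have hgrad : ∀ x, ‖gradient u x‖ = ‖fderiv ℝ u x‖ := fun x ↦ by simp [gradient]
  simp only [hgrad]
  have huc : Continuous fun x ↦ u x ^ 2 := hu.continuous.pow 2
  have hgc : Continuous fun x ↦ ‖fderiv ℝ u x‖ ^ 2 :=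
    ((hu.continuous_fderiv one_ne_zero).norm).pow 2
  have hS : μH[(n : ℝ) - 1] (sphere x₀ d) < ∞ := by
    have := hausdorffMeasure_sphere_lt_top (F := E) (by omega) x₀ hd
    rwa [hfr] at this
  have hSint : IntegrableOn (fun x ↦ u x ^ 2) (sphere x₀ d) μH[(n : ℝ) - 1] := by
    obtain ⟨M, hM⟩ := (isCompact_sphere x₀ d).exists_bound_of_continuousOn huc.continuousOn
    refine Measure.integrableOn_of_bounded hS.ne huc.aestronglyMeasurable (M := M) ?_
    filter_upwards [ae_restrict_mem isClosed_sphere.measurableSet] with x hx using hM x hx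
  set X := ∫ x in sphere x₀ d, u x ^ 2 ∂(μH[(n : ℝ) - 1])
  set Y := ∫ x in closedBall x₀ ρ \ ball x₀ d, ‖fderiv ℝ u x‖ ^ 2
  have hX0 : 0 ≤ X := integral_nonneg fun x ↦ sq_nonneg _
  have hY0 : 0 ≤ Y := integral_nonneg fun x ↦ sq_nonneg _
  have hX : ENNReal.ofReal X = ∫⁻ x in sphere x₀ d, ENNReal.ofReal (u x ^ 2) ∂(μH[(n : ℝ) - 1]) :=
    ofReal_integral_eq_lintegral_ofReal hSint (.of_forall fun x ↦ sq_nonneg _)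
  have hY : ENNReal.ofReal Y =
      ∫⁻ x in closedBall x₀ ρ \ ball x₀ d, ENNReal.ofReal (‖fderiv ℝ u x‖ ^ 2) :=
    ofReal_integral_eq_lintegral_ofReal (hgc.continuousOn.integrableOn_compact hA)
      (.of_forall fun x ↦ sq_nonneg _)
  have hsphere : ∫⁻ ω : sphere (0 : E) 1, ENNReal.ofReal (u (x₀ + d • (ω : E)) ^ 2)
      ∂(volume : Measure E).toSphere ≤ ENNReal.ofReal (K * d ^ ((1 : ℝ) - n) * X) := by
    set φ : sphere (0 : E) 1 → E := fun ω ↦ x₀ + d • (ω : E)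
    have hφ : Measurable φ := by fun_prop
    have hle := map_toSphere_le_hausdorffMeasure (by omega) (volume : Measure E) x₀ hd
    rw [hfr] at hle
    have hmem : ∀ ω, φ ω ∈ sphere x₀ d := fun ω ↦ by
      simp [φ, norm_smul, abs_of_pos hd]
    have hres : ((volume : Measure E).toSphere.map φ).restrict (sphere x₀ d) =
        (volume : Measure E).toSphere.map φ := by
      refine Measure.restrict_eq_self_of_ae_mem ?_
      exact (ae_map_iff (p := (· ∈ sphere x₀ d)) hφ.aemeasurable
        isClosed_sphere.measurableSet).2 (.of_forall hmem)
    rw [ENNReal.ofReal_mul (by positivity), hX, ← smul_eq_mul, ← lintegral_smul_measure,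
      ← Measure.restrict_smul,
      ← lintegral_map (f := fun x ↦ ENNReal.ofReal (u x ^ 2)) (g := φ)
        huc.measurable.ennreal_ofReal hφ, ← hres]
    exact lintegral_mono' (Measure.restrict_mono le_rfl hle) le_rfl
  have hmain := setLIntegral_annulus_sq_le (by omega) (volume : Measure E) x₀ hd hdρ' hI
    (by rw [hfr]; exact integral_inv_pow_le hn hd hdρ' (by linarith)) hu
  rw [hfr, ← hY, ← ofReal_integral_eq_lintegral_ofReal (huc.continuousOn.integrableOn_compact hA)
    (.of_forall fun x ↦ sq_nonneg _)] at hmain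
  have hd1 : 0 ≤ d ^ ((1 : ℝ) - n) := Real.rpow_nonneg hd.le _
  have hfin := hmain.trans (mul_le_mul_right (add_le_add_left (mul_le_mul_right hsphere _) _) _)
  rw [← ENNReal.ofReal_mul zero_le_two, ← ENNReal.ofReal_mul (by positivity),
    ← ENNReal.ofReal_add (by positivity) (by positivity), ← ENNReal.ofReal_mul (by positivity),
    ENNReal.ofReal_le_ofReal_iff (by positivity)] at hfin
  have e1 : 0 ≤ ρ ^ n * d ^ ((1 : ℝ) - n) * X := by positivity
  have e2 : 0 ≤ K * (ρ ^ n * I * Y) := by positivity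
  calc _ ≤ _ := hfin
    _ = 2 * K * (ρ ^ n * d ^ ((1 : ℝ) - n) * X) + 2 * (ρ ^ n * I * Y) := by ring
    _ ≤ 2 * (K + 1) * (ρ ^ n * d ^ ((1 : ℝ) - n) * X) + 2 * (K + 1) * (ρ ^ n * I * Y) := by
        linarith
    _ = _ := by simp only [I]; ring
end

section
/- Let n ≥ 2 be an integer. There exists a constant C > 0, depending only on n, with the following property: for every x₀ ∈ ℝⁿ, all real numbers d, ρ with 0 < 2d ≤ ρ ≤ 1/2, and every continuously differentiable function u : ℝⁿ → ℝ, setting A := {x ∈ ℝⁿ : d ≤ |x − x₀| ≤ ρ}, one has |⟨u⟩_{S(x₀,d)} − ⟨u⟩_A|² ≤ C· d^{2−n} ζ_d ∫_A ‖∇u‖² dx, where ⟨u⟩_{S(x₀,d)} is the mean of u over the sphere S(x₀,d) with respect to H^{n−1} and ⟨u⟩_A is the mean of u over A with respect to Lebesgue measure. -/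
open MeasureTheory Metric Set

theorem sq_integral_mul_le {α : Type*} [MeasurableSpace α] {μ : Measure α} {f g : α → ℝ}
    (hf : Integrable (fun x => f x ^ 2) μ) (hg : Integrable (fun x => g x ^ 2) μ)
    (hfg : Integrable (fun x => f x * g x) μ) :
    (∫ x, f x * g x ∂μ) ^ 2 ≤ (∫ x, f x ^ 2 ∂μ) * ∫ x, g x ^ 2 ∂μ := by
  have key : ∀ t : ℝ, 0 ≤ (∫ x, f x ^ 2 ∂μ) * (t * t) + (-2 * ∫ x, f x * g x ∂μ) * t
      + ∫ x, g x ^ 2 ∂μ := by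
    intro t
    have h0 : 0 ≤ ∫ x, (t * f x - g x) ^ 2 ∂μ := integral_nonneg fun x => sq_nonneg _
    have h1 : ∫ x, (t * f x - g x) ^ 2 ∂μ
        = ∫ x, (t ^ 2 * f x ^ 2 + (-2 * t) * (f x * g x)) + g x ^ 2 ∂μ := by
      congr 1; ext x; ring
    have hf' : Integrable (fun x => t ^ 2 * f x ^ 2) μ := hf.const_mul _
    have hfg' : Integrable (fun x => -2 * t * (f x * g x)) μ := hfg.const_mul _
    have hs : Integrable (fun x => t ^ 2 * f x ^ 2 + -2 * t * (f x * g x)) μ := hf'.add hfg'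
    rw [h1, integral_add hs hg, integral_add hf' hfg', integral_const_mul,
      integral_const_mul] at h0
    linarith
  have := discrim_le_zero key
  rw [discrim] at this
  linarith

theorem average_eq_average_of_measure_ball_eq {X : Type*} [PseudoMetricSpace X] [CompactSpace X]
    [MeasurableSpace X] [BorelSpace X] {μ ν : Measure X} [IsFiniteMeasure μ] [IsFiniteMeasure ν]
    (hμ0 : μ ≠ 0) (hν0 : ν ≠ 0)
    (hμ : ∀ r x y, μ (ball x r) = μ (ball y r)) (hν : ∀ r x y, ν (ball x r) = ν (ball y r))
    {f : X → ℝ} (hf : Continuous f) :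
    ⨍ x, f x ∂μ = ⨍ x, f x ∂ν := by
  have hμp : 0 < μ.real univ := by
    rw [measureReal_def]; exact ENNReal.toReal_pos (by simpa using hμ0) (measure_ne_top _ _)
  have hνp : 0 < ν.real univ := by
    rw [measureReal_def]; exact ENNReal.toReal_pos (by simpa using hν0) (measure_ne_top _ _)
  obtain ⟨x₀⟩ : Nonempty X := by
    by_contra h
    rw [not_nonempty_iff] at h
    exact hμ0 (Measure.eq_zero_of_isEmpty μ)
  refine eq_of_forall_dist_le fun ε hε => ?_
  obtain ⟨r, hr, hfr⟩ := Metric.uniformContinuous_iff.1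
    (CompactSpace.uniformContinuous_of_continuous hf) ε hε
  set b := ν.real (ball x₀ r) with hb
  set a := μ.real (ball x₀ r) with ha
  have hbx : ∀ x, ν.real (ball x r) = b := fun x => by
    rw [hb, measureReal_def, measureReal_def, hν r x x₀]
  have hax : ∀ x, μ.real (ball x r) = a := fun x => by
    rw [ha, measureReal_def, measureReal_def, hμ r x x₀]
  have hb0 : 0 < b := by
    rcases (measureReal_nonneg : 0 ≤ b).eq_or_lt with h | h
    · exfalso
      obtain ⟨t, -, ht⟩ := (isCompact_univ (X := X)).elim_nhds_subcover (fun x : X => ball x r)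
        (fun x _ => ball_mem_nhds x hr)
      have : ν univ ≤ ∑ x ∈ t, ν (ball x r) :=
        (measure_mono ht).trans (measure_biUnion_finset_le _ _)
      have h2 : ∀ x ∈ t, ν (ball x r) = 0 := fun x _ => by
        have := (hbx x).trans h.symm
        rwa [measureReal_eq_zero_iff] at this
      rw [Finset.sum_eq_zero h2] at this
      simp [hν0] at this
    · exact h
  let s : Set (X × X) := {p | dist p.1 p.2 < r}
  have hs : MeasurableSet s := (isOpen_lt continuous_dist continuous_const).measurableSet
  have hsym : ∀ x y, ((x, y) ∈ s ↔ y ∈ ball x r) ∧ ((x, y) ∈ s ↔ x ∈ ball y r) := fun x y => by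
    simp [s, mem_ball, dist_comm]
  have hI : ∀ {g : X × X → ℝ}, Continuous g → Integrable (s.indicator g) (μ.prod ν) := fun hg =>
    (hg.integrable_of_hasCompactSupport (HasCompactSupport.of_compactSpace _)).indicator hs
  have hfst : ∀ {g : X → ℝ}, Continuous g →
      ∫ p, s.indicator (fun p => g p.1) p ∂(μ.prod ν) = b * ∫ x, g x ∂μ := by
    intro g hg
    rw [integral_prod _ (hI (by fun_prop)), ← integral_const_mul]
    congr 1; ext x
    have : (fun y => s.indicator (fun p : X × X => g p.1) (x, y))
        = (ball x r).indicator fun _ => g x := by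
      ext y; classical simpa only [indicator_apply] using if_congr (hsym x y).1 rfl rfl
    rw [this, integral_indicator_const _ measurableSet_ball, hbx, smul_eq_mul]
  have hsnd : ∀ {g : X → ℝ}, Continuous g →
      ∫ p, s.indicator (fun p => g p.2) p ∂(μ.prod ν) = a * ∫ x, g x ∂ν := by
    intro g hg
    rw [integral_prod_symm _ (hI (by fun_prop)), ← integral_const_mul]
    congr 1; ext y
    have : (fun x => s.indicator (fun p : X × X => g p.2) (x, y))
        = (ball y r).indicator fun _ => g y := by
      ext x; classical simpa only [indicator_apply] using if_congr (hsym x y).2 rfl rfl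
    rw [this, integral_indicator_const _ measurableSet_ball, hax, smul_eq_mul]
  have h1 : b * μ.real univ = a * ν.real univ := by
    have := (hfst (g := fun _ => 1) continuous_const).symm.trans
      (hsnd (g := fun _ => 1) continuous_const)
    simpa using this
  have hdiff : |b * ∫ x, f x ∂μ - a * ∫ x, f x ∂ν| ≤ ε * (b * μ.real univ) := by
    have hc : ∫ p, s.indicator (fun _ => ε) p ∂(μ.prod ν) = ε * (b * μ.real univ) := by
      have := hfst (g := fun _ => ε) continuous_const
      rw [this]; simp; ring
    rw [← hfst hf, ← hsnd hf, ← integral_sub (hI (by fun_prop)) (hI (by fun_prop)), ← hc,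
      ← Real.norm_eq_abs]
    refine norm_integral_le_of_norm_le (hI continuous_const) (.of_forall fun p => ?_)
    by_cases hp : p ∈ s
    · simp only [indicator_of_mem hp]
      exact (hfr hp).le
    · simp [indicator_of_notMem hp]
  have e1 : (μ.real univ)⁻¹ * ∫ x, f x ∂μ - (ν.real univ)⁻¹ * ∫ x, f x ∂ν
      = (b * μ.real univ)⁻¹ * (b * ∫ x, f x ∂μ - a * ∫ x, f x ∂ν) := by
    have ha0 : a ≠ 0 := by
      rintro h
      rw [h, zero_mul] at h1
      exact (mul_pos hb0 hμp).ne' h1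
    rw [mul_sub]
    congr 1
    · field_simp
    · rw [h1]; field_simp
  rw [average_eq, average_eq, smul_eq_mul, smul_eq_mul, Real.dist_eq, e1, abs_mul,
    abs_of_pos (inv_pos.2 (mul_pos hb0 hμp)), inv_mul_le_iff₀ (mul_pos hb0 hμp), mul_comm _ ε]
  exact hdiff

section Hausdorff

variable {E : Type*} [NormedAddCommGroup E] [InnerProductSpace ℝ E]

theorem exists_linearIsometryEquiv_apply_eq {x y : E} (h : ‖x‖ = ‖y‖) :
    ∃ g : E ≃ₗᵢ[ℝ] E, g x = y :=
  ⟨(ℝ ∙ (x - y))ᗮ.reflection, Submodule.reflection_sub h⟩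

theorem image_coe_ball_sphere (g : E ≃ₗᵢ[ℝ] E) (x y : sphere (0 : E) 1) (h : g x = y) (r : ℝ) :
    g '' ((↑) '' ball x r) = (↑) '' ball y r := by
  ext z
  simp only [mem_image, exists_exists_and_eq_and, mem_ball, Subtype.dist_eq, ← h]
  constructor
  · rintro ⟨w, hw, rfl⟩
    exact ⟨⟨g w, by simp⟩, by simpa using hw, rfl⟩
  · rintro ⟨w, hw, rfl⟩
    refine ⟨⟨g.symm w, by simp⟩, ?_, by simp⟩
    rw [← g.dist_map]
    simpa using hw

theorem lipschitzWith_normalize_add_orthogonal (v : E) (hv : ‖v‖ = 1) :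
    LipschitzWith 2 (fun y : (ℝ ∙ v)ᗮ => ‖v + (y : E)‖⁻¹ • (v + (y : E))) := by
  have hge : ∀ y : (ℝ ∙ v)ᗮ, 1 ≤ ‖v + (y : E)‖ := fun y => by
    have h0 : inner ℝ v (y : E) = 0 := (Submodule.mem_orthogonal_singleton_iff_inner_right).1 y.2
    have h1 := norm_add_sq_eq_norm_sq_add_norm_sq_real h0
    nlinarith [norm_nonneg (v + (y : E)), norm_nonneg (y : E)]
  refine LipschitzWith.of_dist_le_mul fun y z => ?_
  set a := v + (y : E) with ha
  set b := v + (z : E) with hb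
  have hab : dist y z = ‖a - b‖ := by
    rw [Subtype.dist_eq, dist_eq_norm, ha, hb]; congr 1; abel
  have ha1 := hge y
  have hb1 := hge z
  rw [← ha] at ha1
  rw [← hb] at hb1
  have ha0 : ‖a‖ ≠ 0 := by positivity
  have hb0 : ‖b‖ ≠ 0 := by positivity
  have e : ‖a‖⁻¹ • a - ‖b‖⁻¹ • b
      = ‖a‖⁻¹ • (a - b) + (‖a‖⁻¹ * (‖b‖ - ‖a‖)) • (‖b‖⁻¹ • b) := by
    have h3 : ‖a‖⁻¹ * (‖b‖ - ‖a‖) * ‖b‖⁻¹ = ‖a‖⁻¹ - ‖b‖⁻¹ := by field_simp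
    rw [smul_smul, h3, smul_sub, sub_smul]; abel
  have hbn : ‖‖b‖⁻¹ • b‖ = 1 := by
    rw [norm_smul, norm_inv, norm_norm, inv_mul_cancel₀ hb0]
  have hia : ‖a‖⁻¹ ≤ 1 := inv_le_one_of_one_le₀ ha1
  have hd : |‖b‖ - ‖a‖| ≤ ‖a - b‖ := by rw [norm_sub_rev]; exact abs_norm_sub_norm_le b a
  have hi0 : 0 ≤ ‖a‖⁻¹ := by positivity
  calc dist (‖a‖⁻¹ • a) (‖b‖⁻¹ • b) = ‖‖a‖⁻¹ • a - ‖b‖⁻¹ • b‖ := dist_eq_norm _ _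
    _ ≤ ‖a‖⁻¹ * ‖a - b‖ + ‖a‖⁻¹ * |‖b‖ - ‖a‖| := by
      rw [e]
      refine (norm_add_le _ _).trans (le_of_eq ?_)
      rw [norm_smul, norm_smul, hbn, mul_one, norm_mul, norm_inv, norm_norm, Real.norm_eq_abs]
    _ ≤ 1 * ‖a - b‖ + 1 * ‖a - b‖ := by gcongr
    _ = (2 : NNReal) * dist y z := by rw [hab]; push_cast; ring

variable [FiniteDimensional ℝ E]

theorem finrank_orthogonal_span_singleton_cast {v : E} (hv : v ≠ 0) :
    ((Module.finrank ℝ (ℝ ∙ v)ᗮ : ℕ) : ℝ) = (Module.finrank ℝ E : ℝ) - 1 := by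
  have h1 := (ℝ ∙ v).finrank_add_finrank_orthogonal
  rw [finrank_span_singleton hv] at h1
  rw [← h1]; push_cast; ring

variable [MeasurableSpace E] [BorelSpace E]

theorem hausdorffMeasure_sphere_lt_top_s4 (hE : 1 ≤ Module.finrank ℝ E) :
    μH[(Module.finrank ℝ E : ℝ) - 1] (sphere (0 : E) 1) < ⊤ := by
  have hE' : (0 : ℝ) ≤ (Module.finrank ℝ E : ℝ) - 1 := by
    have : (1 : ℝ) ≤ Module.finrank ℝ E := by exact_mod_cast hE
    linarith
  refine (isCompact_sphere (0 : E) 1).measure_lt_top_of_nhdsWithin fun v hv => ?_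
  have hv1 : ‖v‖ = 1 := by simpa using hv
  have hv0 : v ≠ 0 := by rintro rfl; simp at hv1
  have hL := lipschitzWith_normalize_add_orthogonal v hv1
  refine ⟨{x | 1 / 2 < inner ℝ v x} ∩ sphere 0 1,
    Filter.inter_mem (mem_nhdsWithin_of_mem_nhds ?_) self_mem_nhdsWithin, ?_⟩
  · refine (isOpen_lt continuous_const (by fun_prop)).mem_nhds ?_
    simp [hv1]; norm_num
  · have hsub : {x | 1 / 2 < inner ℝ v x} ∩ sphere (0 : E) 1 ⊆
        (fun y : (ℝ ∙ v)ᗮ => ‖v + (y : E)‖⁻¹ • (v + (y : E))) '' closedBall 0 3 := by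
      rintro x ⟨hx, hx1⟩
      have hx1 : ‖x‖ = 1 := by simpa using hx1
      have hx : 1 / 2 < inner ℝ v x := hx
      set c := inner ℝ v x with hc
      have hc0 : 0 < c := by linarith
      have hmem : c⁻¹ • x - v ∈ (ℝ ∙ v)ᗮ := by
        rw [Submodule.mem_orthogonal_singleton_iff_inner_right, inner_sub_right, inner_smul_right,
          ← hc, real_inner_self_eq_norm_sq, hv1, inv_mul_cancel₀ hc0.ne']
        norm_num
      refine ⟨⟨_, hmem⟩, ?_, ?_⟩
      · rw [mem_closedBall_zero_iff, Submodule.coe_norm]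
        refine (norm_sub_le _ _).trans ?_
        rw [norm_smul, hx1, hv1, norm_inv, Real.norm_of_nonneg hc0.le]
        have : c⁻¹ ≤ 2 := by
          rw [inv_le_comm₀ hc0 (by norm_num)]; linarith
        linarith
      · simp only [add_sub_cancel, norm_smul, hx1, norm_inv, Real.norm_of_nonneg hc0.le, mul_one,
          inv_inv, smul_smul, mul_inv_cancel₀ hc0.ne', one_smul]
    refine (measure_mono hsub).trans_lt ((hL.hausdorffMeasure_image_le hE' _).trans_lt ?_)
    rw [← finrank_orthogonal_span_singleton_cast hv0]
    refine ENNReal.mul_lt_top (by simp) ?_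
    exact (isCompact_closedBall _ _).measure_lt_top

theorem hausdorffMeasure_sphere_pos (hE : 1 ≤ Module.finrank ℝ E) :
    0 < μH[(Module.finrank ℝ E : ℝ) - 1] (sphere (0 : E) 1) := by
  have hE' : (0 : ℝ) ≤ (Module.finrank ℝ E : ℝ) - 1 := by
    have : (1 : ℝ) ≤ Module.finrank ℝ E := by exact_mod_cast hE
    linarith
  have : Nontrivial E := Module.nontrivial_of_finrank_pos (R := ℝ) (by omega)
  obtain ⟨v, hv1⟩ := exists_norm_eq E zero_le_one
  have hv0 : v ≠ 0 := by rintro rfl; simp at hv1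
  refine lt_of_lt_of_le ?_
    (hausdorffMeasure_orthogonalProjectionOnto_le (𝕜 := ℝ) (ℝ ∙ v)ᗮ _ (sphere (0 : E) 1) hE')
  rw [← finrank_orthogonal_span_singleton_cast hv0]
  refine (isOpen_ball.measure_pos _ (nonempty_ball.2 one_pos)).trans_le
    (measure_mono (s := ball (0 : (ℝ ∙ v)ᗮ) 1) ?_)
  intro y hy
  have hy1 : ‖y‖ < 1 := by simpa using hy
  have h0 : inner ℝ (y : E) v = 0 := by
    rw [real_inner_comm]
    exact (Submodule.mem_orthogonal_singleton_iff_inner_right).1 y.2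
  refine ⟨(y : E) + √(1 - ‖y‖ ^ 2) • v, ?_, ?_⟩
  · have h1 := norm_add_sq_eq_norm_sq_add_norm_sq_real
      (x := (y : E)) (y := √(1 - ‖y‖ ^ 2) • v) (by rw [inner_smul_right, h0, mul_zero])
    have h2 : 0 ≤ 1 - ‖y‖ ^ 2 := by nlinarith [norm_nonneg y]
    rw [norm_smul, hv1, mul_one, Real.norm_of_nonneg (Real.sqrt_nonneg _),
      Real.mul_self_sqrt h2, ← Submodule.coe_norm] at h1
    rw [mem_sphere_zero_iff_norm]
    nlinarith [norm_nonneg ((y : E) + √(1 - ‖y‖ ^ 2) • v)]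
  · rw [map_add, map_smul, Submodule.orthogonalProjectionOnto_mem_subspace_eq_self]
    rw [Submodule.orthogonalProjectionOnto_orthogonal_apply_eq_zero
      (Submodule.mem_span_singleton_self v)]
    simp

open scoped Pointwise in
theorem toSphere_ball_eq_toSphere_ball (r : ℝ) (x y : sphere (0 : E) 1) :
    (volume : Measure E).toSphere (ball x r) = (volume : Measure E).toSphere (ball y r) := by
  obtain ⟨g, hg⟩ := exists_linearIsometryEquiv_apply_eq (x := (x : E)) (y := y) (by simp)
  rw [Measure.toSphere_apply' _ measurableSet_ball, Measure.toSphere_apply' _ measurableSet_ball,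
    ← image_coe_ball_sphere g x y hg]
  have : Ioo (0 : ℝ) 1 • (g '' ((↑) '' ball x r)) = g '' (Ioo (0 : ℝ) 1 • ((↑) '' ball x r)) := by
    ext z
    simp only [mem_smul, mem_image]
    constructor
    · rintro ⟨t, ht, _, ⟨w, hw, rfl⟩, rfl⟩
      exact ⟨_, ⟨t, ht, w, hw, rfl⟩, by simp⟩
    · rintro ⟨_, ⟨t, ht, w, hw, rfl⟩, rfl⟩
      exact ⟨t, ht, _, ⟨w, hw, rfl⟩, by simp⟩
  rw [this, ← g.measurePreserving.measure_preimage_emb g.toHomeomorph.measurableEmbedding (g '' _),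
    preimage_image_eq _ g.injective]

theorem average_sphere_hausdorffMeasure (hE : 1 ≤ Module.finrank ℝ E) (x₀ : E) {d : ℝ} (hd : 0 < d)
    {u : E → ℝ} (hu : Continuous u) :
    ⨍ x in sphere x₀ d, u x ∂μH[(Module.finrank ℝ E : ℝ) - 1]
      = ⨍ ω : sphere (0 : E) 1, u (x₀ + d • (ω : E)) ∂(volume : Measure E).toSphere := by
  have hE' : (0 : ℝ) ≤ (Module.finrank ℝ E : ℝ) - 1 := by
    have : (1 : ℝ) ≤ Module.finrank ℝ E := by exact_mod_cast hE
    linarith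
  have : Nontrivial E := Module.nontrivial_of_finrank_pos (R := ℝ) (by omega)
  let H : Measure E := μH[(Module.finrank ℝ E : ℝ) - 1]
  let J : E → E := fun x => x₀ + d • x
  have hJc : Continuous J := by fun_prop
  have hJi : Function.Injective J := fun x y h => by
    simpa [J, hd.ne'] using h
  let j : sphere (0 : E) 1 → E := fun ω => J ω
  have hj : MeasurableEmbedding j :=
    ((hJc.comp continuous_subtype_val).isClosedEmbedding
      (hJi.comp Subtype.val_injective)).measurableEmbedding
  have hJs : J '' sphere 0 1 = sphere x₀ d := by
    ext z
    simp only [mem_image, mem_sphere_iff_norm, sub_zero]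
    constructor
    · rintro ⟨w, hw, rfl⟩
      simp [J, norm_smul, hw, abs_of_pos hd]
    · intro h
      refine ⟨d⁻¹ • (z - x₀), ?_, ?_⟩
      · rw [norm_smul, h, norm_inv, Real.norm_of_nonneg hd.le, inv_mul_cancel₀ hd.ne']
      · simp [J, smul_smul, hd.ne']
  have hrange : range j = sphere x₀ d := by
    rw [← hJs, image_eq_range]
  have hJd : ∀ x y, dist (J x) (J y) = d * dist x y := fun x y => by
    simp [J, dist_smul₀, abs_of_pos hd]
  have hJL : LipschitzWith d.toNNReal J := LipschitzWith.of_dist_le_mul fun x y => by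
    rw [hJd, Real.coe_toNNReal _ hd.le]
  have hJA : AntilipschitzWith (d⁻¹).toNNReal J := AntilipschitzWith.of_le_mul_dist fun x y => by
    rw [hJd, Real.coe_toNNReal _ (inv_pos.2 hd).le, inv_mul_cancel_left₀ hd.ne']
  have hfin : H (sphere x₀ d) < ⊤ := by
    rw [← hJs]
    refine (hJL.hausdorffMeasure_image_le hE' _).trans_lt
      (ENNReal.mul_lt_top ?_ (hausdorffMeasure_sphere_lt_top_s4 hE))
    exact ENNReal.rpow_lt_top_of_nonneg hE' (by simp)
  have hpos : H (sphere x₀ d) ≠ 0 := by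
    intro h0
    have := hJA.le_hausdorffMeasure_image hE' (sphere 0 1)
    rw [hJs] at this
    rw [show μH[(Module.finrank ℝ E : ℝ) - 1] (sphere x₀ d) = 0 from h0, mul_zero] at this
    exact (hausdorffMeasure_sphere_pos hE).not_ge this
  let μ : Measure (sphere (0 : E) 1) := H.comap j
  have hμa : ∀ s, μ s = H (j '' s) := fun s => hj.comap_apply H s
  have hμu : μ univ = H (sphere x₀ d) := by rw [hμa, image_univ, hrange]
  have : IsFiniteMeasure μ := ⟨by rw [hμu]; exact hfin⟩
  have hμ0 : μ ≠ 0 := by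
    intro h; rw [h] at hμu; exact hpos (by simpa using hμu.symm)
  have hμball : ∀ r x y, μ (ball x r) = μ (ball y r) := by
    intro r x y
    obtain ⟨g, hg⟩ := exists_linearIsometryEquiv_apply_eq (x := (x : E)) (y := y) (by simp)
    let e : E ≃ᵢ E := ((IsometryEquiv.addLeft (-x₀)).trans g.toIsometryEquiv).trans
      (IsometryEquiv.addLeft x₀)
    have he : ∀ z, e (J z) = J (g z) := fun z => by simp [e, J]
    have hjb : j '' ball y r = e '' (j '' ball x r) := by
      have h1 : ∀ s : Set (sphere (0 : E) 1), j '' s = J '' ((↑) '' s) := fun s => by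
        rw [image_image]
      rw [h1, h1, ← image_coe_ball_sphere g x y hg]
      simp only [image_image, he]
    rw [hμa, hμa, hjb]
    exact (e.hausdorffMeasure_image _ _).symm
  have key := average_eq_average_of_measure_ball_eq hμ0
    (Measure.toSphere_ne_zero (volume : Measure E)) hμball toSphere_ball_eq_toSphere_ball
    (f := fun ω => u (j ω)) (by fun_prop)
  rw [show (fun ω : sphere (0 : E) 1 => u (x₀ + d • (ω : E))) = fun ω => u (j ω) from rfl, ← key]
  rw [← hrange, average_eq, average_eq, measureReal_def, measureReal_def, hμu,
    Measure.restrict_apply_univ, hrange, ← hrange, ← hj.map_comap, hj.integral_map]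

end Hausdorff

theorem sq_intervalIntegral_deriv_le {m : ℕ} {d ρ r : ℝ} (hd : 0 < d) (hdr : d ≤ r) (hr : r ≤ ρ)
    {h h' p : ℝ → ℝ} (hh : ∀ s, HasDerivAt h (h' s) s) (hh' : Continuous h') (hp : Continuous p)
    (hle : ∀ s, h' s ^ 2 ≤ p s) :
    (h d - h r) ^ 2 ≤ (∫ s in d..ρ, (s ^ m)⁻¹) * ∫ s in Icc d ρ, s ^ m * p s := by
  have hdρ : d ≤ ρ := hdr.trans hr
  have hpos : ∀ s ∈ Icc d ρ, 0 < s := fun s hs => hd.trans_le hs.1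
  have hsub : Icc d r ⊆ Icc d ρ := Icc_subset_Icc_right hr
  have hci : ∀ a ≤ ρ, ContinuousOn (fun s : ℝ => (s ^ m)⁻¹) (Icc d a) := fun a ha =>
    (continuous_pow m).continuousOn.inv₀ fun s hs =>
      (pow_pos (hpos s ⟨hs.1, hs.2.trans ha⟩) m).ne'
  have hint : ∀ {a : ℝ} {f : ℝ → ℝ}, ContinuousOn f (Icc d a) →
      IntegrableOn f (Icc d a) := fun hf => hf.integrableOn_compact isCompact_Icc
  have hftc : h r - h d = ∫ s in Icc d r, h' s := by
    rw [integral_Icc_eq_integral_Ioc, ← intervalIntegral.integral_of_le hdr]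
    exact (intervalIntegral.integral_eq_sub_of_hasDerivAt (fun s _ => hh s)
      (hh'.intervalIntegrable _ _)).symm
  have hsq : ContinuousOn (fun s : ℝ => √(s ^ m)) (Icc d r) := by fun_prop
  have hsq0 : ∀ s ∈ Icc d r, √(s ^ m) ≠ 0 := fun s hs =>
    (Real.sqrt_pos.2 (pow_pos (hpos s (hsub hs)) m)).ne'
  have hcs := sq_integral_mul_le (μ := volume.restrict (Icc d r))
    (f := fun s => (√(s ^ m))⁻¹) (g := fun s => √(s ^ m) * h' s)
    (hint ((hsq.inv₀ hsq0).pow 2)) (hint ((hsq.mul hh'.continuousOn).pow 2))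
    (hint ((hsq.inv₀ hsq0).mul (hsq.mul hh'.continuousOn)))
  have e1 : ∫ s in Icc d r, (√(s ^ m))⁻¹ * (√(s ^ m) * h' s) = h r - h d := by
    rw [hftc]
    exact setIntegral_congr_fun measurableSet_Icc fun s hs => inv_mul_cancel_left₀ (hsq0 s hs) _
  have e2 : ∫ s in Icc d r, ((√(s ^ m))⁻¹) ^ 2 = ∫ s in Icc d r, (s ^ m)⁻¹ :=
    setIntegral_congr_fun measurableSet_Icc fun s hs => by
      simp only [inv_pow, Real.sq_sqrt (pow_pos (hpos s (hsub hs)) m).le]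
  have e3 : ∫ s in Icc d r, (√(s ^ m) * h' s) ^ 2 = ∫ s in Icc d r, s ^ m * h' s ^ 2 :=
    setIntegral_congr_fun measurableSet_Icc fun s hs => by
      simp only [mul_pow, Real.sq_sqrt (pow_pos (hpos s (hsub hs)) m).le]
  rw [e1, e2, e3] at hcs
  have hb1 : ∫ s in Icc d r, (s ^ m)⁻¹ ≤ ∫ s in d..ρ, (s ^ m)⁻¹ := by
    rw [intervalIntegral.integral_of_le hdρ, ← integral_Icc_eq_integral_Ioc]
    refine setIntegral_mono_set (hint (hci ρ le_rfl)) ?_ hsub.eventuallyLE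
    exact ae_restrict_of_forall_mem measurableSet_Icc fun s hs =>
      (inv_pos.2 (pow_pos (hpos s hs) m)).le
  have hb2 : ∫ s in Icc d r, s ^ m * h' s ^ 2 ≤ ∫ s in Icc d ρ, s ^ m * p s := by
    have hcp : ContinuousOn (fun s => s ^ m * p s) (Icc d ρ) := by fun_prop
    have hch : ContinuousOn (fun s => s ^ m * h' s ^ 2) (Icc d r) := by fun_prop
    refine (setIntegral_mono_on (hint hch) (hint (hcp.mono hsub)) measurableSet_Icc
      fun s hs => mul_le_mul_of_nonneg_left (hle s) (pow_pos (hpos s (hsub hs)) m).le).trans ?_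
    refine setIntegral_mono_set (hint hcp) ?_ hsub.eventuallyLE
    exact ae_restrict_of_forall_mem measurableSet_Icc fun s hs =>
      mul_nonneg (pow_pos (hpos s hs) m).le ((sq_nonneg _).trans (hle s))
  have hn1 : 0 ≤ ∫ s in Icc d r, s ^ m * h' s ^ 2 :=
    setIntegral_nonneg measurableSet_Icc fun s hs =>
      mul_nonneg (pow_pos (hpos s (hsub hs)) m).le (sq_nonneg _)
  have hn2 : 0 ≤ ∫ s in d..ρ, (s ^ m)⁻¹ :=
    intervalIntegral.integral_nonneg hdρ fun s hs => (inv_pos.2 (pow_pos (hpos s hs) m)).le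
  rw [← neg_sub, neg_sq]
  exact hcs.trans (mul_le_mul hb1 hb2 hn1 hn2)

theorem intervalIntegral_inv_pow_le {n : ℕ} (hn : 2 ≤ n) {d ρ : ℝ} (hd : 0 < d) (hdρ : d ≤ ρ)
    (hρ : ρ ≤ 1) :
    ∫ s in d..ρ, (s ^ (n - 1))⁻¹ ≤ d ^ ((2 : ℝ) - n) * (if n = 2 then |Real.log d| else 1) := by
  have h0 : (0 : ℝ) ∉ uIcc d ρ := by
    rw [uIcc_of_le hdρ]; exact fun h => hd.not_ge h.1
  have hρ0 : 0 < ρ := hd.trans_le hdρ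
  split_ifs with h2
  · subst h2
    have : ∫ s in d..ρ, (s ^ (2 - 1))⁻¹ = Real.log ρ - Real.log d := by
      simp only [Nat.add_one_sub_one, pow_one]
      rw [integral_inv h0, Real.log_div hρ0.ne' hd.ne']
    rw [this]
    norm_num
    have h1 := Real.log_nonpos hρ0.le hρ
    have h3 := neg_le_abs (Real.log d)
    linarith
  · have h3 : (3 : ℝ) ≤ n := by exact_mod_cast (show 3 ≤ n by omega)
    have hcast : ((n - 1 : ℕ) : ℝ) = n - 1 := by rw [Nat.cast_sub (by omega)]; simp
    have e : ∫ s in d..ρ, (s ^ (n - 1))⁻¹ = ∫ s in d..ρ, s ^ (1 - (n : ℝ)) := by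
      refine intervalIntegral.integral_congr fun s hs => ?_
      rw [uIcc_of_le hdρ] at hs
      have hs0 : 0 < s := hd.trans_le hs.1
      rw [← Real.rpow_natCast, ← Real.rpow_neg hs0.le, hcast, neg_sub]
    rw [e, integral_rpow (Or.inr ⟨by linarith, h0⟩), mul_one,
      show 1 - (n : ℝ) + 1 = 2 - n by ring]
    have hp := Real.rpow_pos_of_pos hρ0 (2 - (n : ℝ))
    have hq := Real.rpow_pos_of_pos hd (2 - (n : ℝ))
    rw [div_le_iff_of_neg (by linarith)]
    nlinarith

section Polar

variable {E : Type*} [NormedAddCommGroup E] [NormedSpace ℝ E] [FiniteDimensional ℝ E]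
  [MeasurableSpace E] [BorelSpace E] (μ : Measure E) [μ.IsAddHaarMeasure]

theorem measurePreserving_polar_annulus [Nontrivial E] (x₀ : E) (d ρ : ℝ) :
    MeasurePreserving (fun p : sphere (0 : E) 1 × Ioi (0 : ℝ) => x₀ + (p.2 : ℝ) • (p.1 : E))
      (μ.toSphere.prod ((Measure.volumeIoiPow (Module.finrank ℝ E - 1)).restrict
        ((↑) ⁻¹' Icc d ρ)))
      (μ.restrict (closedBall x₀ ρ \ ball x₀ d)) := by
  have h1 : MeasurePreserving (homeomorphUnitSphereProd E).symm
      (μ.toSphere.prod (Measure.volumeIoiPow (Module.finrank ℝ E - 1))) (μ.comap (↑)) :=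
    μ.measurePreserving_homeomorphUnitSphereProd.symm
      (homeomorphUnitSphereProd E).toMeasurableEquiv
  have h2 : MeasurePreserving ((↑) : ({0}ᶜ : Set E) → E) (μ.comap (↑)) μ := by
    refine ⟨measurable_subtype_coe, ?_⟩
    rw [map_comap_subtype_coe (measurableSet_singleton _).compl, restrict_compl_singleton]
  have h3 := (measurePreserving_add_left μ x₀).comp (h2.comp h1)
  have hA : MeasurableSet (closedBall x₀ ρ \ ball x₀ d) :=
    measurableSet_closedBall.diff measurableSet_ball
  have h4 := h3.restrict_preimage hA
  have h5 : (fun x => x₀ + x) ∘ ((↑) : ({0}ᶜ : Set E) → E) ∘ (homeomorphUnitSphereProd E).symm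
      = fun p : sphere (0 : E) 1 × Ioi (0 : ℝ) => x₀ + (p.2 : ℝ) • (p.1 : E) := by
    ext p; simp
  rw [h5] at h4
  convert h4 using 1
  rw [← Measure.restrict_univ (μ := μ.toSphere), Measure.prod_restrict, Measure.restrict_univ]
  congr 1
  ext ⟨ω, r⟩
  have hr : 0 < (r : ℝ) := r.2
  simp [norm_smul, abs_of_pos hr, and_comm]

theorem integral_volumeIoiPow_restrict_Icc (m : ℕ) {d ρ : ℝ} (hd : 0 < d) (f : ℝ → ℝ) :
    ∫ r, f r ∂((Measure.volumeIoiPow m).restrict (((↑) : Ioi (0 : ℝ) → ℝ) ⁻¹' Icc d ρ))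
      = ∫ s in Icc d ρ, s ^ m * f s := by
  have hm : Measurable fun r : Ioi (0 : ℝ) => Real.toNNReal (r.1 ^ m) :=
    (measurable_subtype_coe.pow_const _).real_toNNReal
  have hI : MeasurableSet (((↑) : Ioi (0 : ℝ) → ℝ) ⁻¹' Icc d ρ) :=
    measurable_subtype_coe measurableSet_Icc
  simp only [Measure.volumeIoiPow, ENNReal.ofReal]
  rw [restrict_withDensity hI, integral_withDensity_eq_integral_smul hm, ← integral_indicator hI]
  have : ((((↑) : Ioi (0 : ℝ) → ℝ) ⁻¹' Icc d ρ).indicator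
      fun r => Real.toNNReal (r.1 ^ m) • f r)
      = fun r : Ioi (0 : ℝ) => (Icc d ρ).indicator (fun s => s ^ m * f s) r := by
    ext r
    by_cases h : (r : ℝ) ∈ Icc d ρ
    · rw [indicator_of_mem h, indicator_of_mem (s := ((↑) : Ioi (0 : ℝ) → ℝ) ⁻¹' Icc d ρ) h,
        NNReal.smul_def, Real.coe_toNNReal _ (pow_nonneg (le_of_lt r.2) _), smul_eq_mul]
    · rw [indicator_of_notMem h, indicator_of_notMem (s := ((↑) : Ioi (0 : ℝ) → ℝ) ⁻¹' Icc d ρ) h]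
  rw [this, integral_subtype_comap measurableSet_Ioi
    (fun r => (Icc d ρ).indicator (fun s => s ^ m * f s) r), setIntegral_indicator measurableSet_Icc,
    inter_eq_self_of_subset_right fun s (hs : s ∈ Icc d ρ) => mem_Ioi.2 (hd.trans_le hs.1)]

end Polar

/-- Mean-value comparison between the inner sphere and the annulus: for `n ≥ 2` there is
`C > 0` depending only on `n` such that for all `x₀ ∈ ℝⁿ`, `0 < 2d ≤ ρ ≤ 1/2` and every `C¹`
function `u`, with `A = {x : d ≤ |x - x₀| ≤ ρ}`,
`|⟨u⟩_{S(x₀,d)} - ⟨u⟩_A|² ≤ C d^{2-n} ζ_d ∫_A ‖∇u‖²`,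
where the first mean is with respect to `H^{n-1}` on the sphere and the second with respect
to Lebesgue measure on `A`, and `ζ_d = 1` for `n ≥ 3`, `ζ_d = |log d|` for `n = 2`. -/
theorem mean_sphere_annulus_estimate (n : ℕ) (hn : 2 ≤ n) :
    ∃ C > (0 : ℝ), ∀ (x₀ : EuclideanSpace ℝ (Fin n)) (d ρ : ℝ),
      0 < d → 2 * d ≤ ρ → ρ ≤ 1 / 2 →
      ∀ u : EuclideanSpace ℝ (Fin n) → ℝ, ContDiff ℝ 1 u →
        |(⨍ x in sphere x₀ d, u x ∂(μH[(n : ℝ) - 1]))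
            - ⨍ x in closedBall x₀ ρ \ ball x₀ d, u x| ^ 2 ≤
          C * d ^ ((2 : ℝ) - n) * (if n = 2 then |Real.log d| else 1)
            * (∫ x in closedBall x₀ ρ \ ball x₀ d, ‖gradient u x‖ ^ 2) := by
  have hfr : Module.finrank ℝ (EuclideanSpace ℝ (Fin n)) = n := by simp
  have : Nontrivial (EuclideanSpace ℝ (Fin n)) :=
    Module.nontrivial_of_finrank_pos (R := ℝ) (by rw [hfr]; omega)
  let σ := (volume : Measure (EuclideanSpace ℝ (Fin n))).toSphere
  have hσ : 0 < σ.real univ := by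
    rw [measureReal_def]
    exact ENNReal.toReal_pos (by simpa using Measure.toSphere_ne_zero _) (measure_ne_top _ _)
  refine ⟨(σ.real univ)⁻¹, inv_pos.2 hσ, fun x₀ d ρ hd h2d hρ u hu => ?_⟩
  have hdρ : d < ρ := by linarith
  set ν := (Measure.volumeIoiPow (n - 1)).restrict (((↑) : Ioi (0 : ℝ) → ℝ) ⁻¹' Icc d ρ) with hν
  set A := closedBall x₀ ρ \ ball x₀ d with hA
  have hAc : IsCompact A := (isCompact_closedBall x₀ ρ).diff isOpen_ball
  have hΦ := measurePreserving_polar_annulus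
    (volume : Measure (EuclideanSpace ℝ (Fin n))) x₀ d ρ
  rw [hfr, ← hν, ← hA] at hΦ
  have hm := average_sphere_hausdorffMeasure (by omega) x₀ hd hu.continuous
  rw [hfr] at hm
  rw [hm]
  set P := σ.prod ν with hP
  set F : EuclideanSpace ℝ (Fin n) → ℝ := fun x => ‖gradient u x‖ ^ 2 with hF
  have hgrad : Continuous (gradient u) :=
    (InnerProductSpace.toDual ℝ _).symm.continuous.comp (hu.continuous_fderiv one_ne_zero)
  have hFc : Continuous F := (hgrad.norm).pow 2
  have hνfin : IsFiniteMeasure ν := by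
    have hρ1 : 0 < ρ + 1 := by linarith
    refine ⟨?_⟩
    rw [hν, Measure.restrict_apply_univ]
    refine (measure_mono (t := Iio (⟨ρ + 1, hρ1⟩ : Ioi (0 : ℝ))) fun r hr => ?_).trans_lt
      (by rw [Measure.volumeIoiPow_apply_Iio]; exact ENNReal.ofReal_lt_top)
    exact Subtype.coe_lt_coe.1 (lt_of_le_of_lt hr.2 (lt_add_one ρ))
  have hνint : ∀ f : ℝ → ℝ, ∫ r, f r ∂ν = ∫ s in Icc d ρ, s ^ (n - 1) * f s := fun f =>
    integral_volumeIoiPow_restrict_Icc (n - 1) hd f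
  have hνpos : 0 < ν.real univ := by
    have h1 : ν.real univ = ∫ s in d..ρ, s ^ (n - 1) := by
      have := hνint fun _ => 1
      rw [integral_const, smul_eq_mul, mul_one, integral_Icc_eq_integral_Ioc,
        ← intervalIntegral.integral_of_le hdρ.le] at this
      simpa using this
    rw [h1]
    exact intervalIntegral.intervalIntegral_pos_of_pos_on
      ((continuous_pow _).intervalIntegrable _ _) (fun s hs => pow_pos (hd.trans hs.1) _) hdρ
  have hPr : P.real univ = σ.real univ * ν.real univ := by
    rw [hP, ← univ_prod_univ, measureReal_prod_prod]
  have hAint : ∀ {f : EuclideanSpace ℝ (Fin n) → ℝ}, Continuous f →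
      Integrable (fun p : sphere (0 : EuclideanSpace ℝ (Fin n)) 1 × Ioi (0 : ℝ) =>
        f (x₀ + (p.2 : ℝ) • (p.1 : EuclideanSpace ℝ (Fin n)))) P ∧
      ∫ p : sphere (0 : EuclideanSpace ℝ (Fin n)) 1 × Ioi (0 : ℝ),
        f (x₀ + (p.2 : ℝ) • (p.1 : EuclideanSpace ℝ (Fin n))) ∂P = ∫ x in A, f x := by
    intro f hf
    have hi : IntegrableOn f A := hf.continuousOn.integrableOn_compact hAc
    refine ⟨hΦ.integrable_comp_of_integrable hi, ?_⟩
    rw [← hΦ.map_eq, integral_map hΦ.measurable.aemeasurable (by fun_prop)]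
  obtain ⟨hui, hue⟩ := hAint hu.continuous
  obtain ⟨hFi, hFe⟩ := hAint hFc
  have hAv : volume.real A = P.real univ := by
    have := (hAint (f := fun _ => 1) continuous_const).2
    simpa using this.symm
  let v : sphere (0 : EuclideanSpace ℝ (Fin n)) 1 → ℝ := fun ω => u (x₀ + d • (ω : _))
  have hvc : Continuous v := hu.continuous.comp (by fun_prop)
  have hvi : Integrable v σ :=
    hvc.integrable_of_hasCompactSupport (HasCompactSupport.of_compactSpace _)
  have hvP : Integrable (fun p : _ × Ioi (0 : ℝ) => v p.1) P := hvi.comp_fst ν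
  let f : sphere (0 : EuclideanSpace ℝ (Fin n)) 1 × Ioi (0 : ℝ) → ℝ := fun p =>
    v p.1 - u (x₀ + (p.2 : ℝ) • (p.1 : EuclideanSpace ℝ (Fin n)))
  have hfi : Integrable f P := hvP.sub hui
  have hdiff : ⨍ ω, v ω ∂σ - ⨍ x in A, u x = (P.real univ)⁻¹ * ∫ p, f p ∂P := by
    have e1 : ∫ p, f p ∂P = ν.real univ * ∫ ω, v ω ∂σ - ∫ x in A, u x := by
      rw [integral_sub hvP hui, hue, hP, integral_fun_fst, smul_eq_mul]
    rw [e1, average_eq, setAverage_eq, hAv, hPr, smul_eq_mul, smul_eq_mul]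
    field_simp
  let G : sphere (0 : EuclideanSpace ℝ (Fin n)) 1 → ℝ := fun ω =>
    ∫ r : Ioi (0 : ℝ), F (x₀ + (r : ℝ) • (ω : EuclideanSpace ℝ (Fin n))) ∂ν
  have hGi : Integrable G σ := hFi.integral_prod_left
  have hGe : ∫ ω, G ω ∂σ = ∫ x in A, F x := by rw [← hFe, integral_prod _ hFi]
  set L := ∫ s in d..ρ, (s ^ (n - 1))⁻¹ with hL
  have hbound : ∀ᵐ p ∂P, f p ^ 2 ≤ L * G p.1 := by
    have hmem : ∀ᵐ p ∂P, ((p.2 : Ioi (0 : ℝ)) : ℝ) ∈ Icc d ρ :=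
      Measure.quasiMeasurePreserving_snd.ae
        (ae_restrict_mem (measurable_subtype_coe measurableSet_Icc))
    filter_upwards [hmem] with ⟨ω, r⟩ hr
    have hG : G ω = ∫ s in Icc d ρ, s ^ (n - 1)
        * F (x₀ + s • (ω : EuclideanSpace ℝ (Fin n))) :=
      hνint fun s => F (x₀ + s • (ω : EuclideanSpace ℝ (Fin n)))
    have hline : ∀ s : ℝ,
        HasDerivAt (fun s : ℝ => x₀ + s • (ω : EuclideanSpace ℝ (Fin n))) ω s := fun s => by
      simpa using ((hasDerivAt_id s).smul_const (ω : EuclideanSpace ℝ (Fin n))).const_add x₀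
    have hder : ∀ s : ℝ, HasDerivAt (fun s : ℝ => u (x₀ + s • (ω : EuclideanSpace ℝ (Fin n))))
        (inner ℝ (gradient u (x₀ + s • (ω : EuclideanSpace ℝ (Fin n)))) ω) s := fun s => by
      have := ((hu.differentiable one_ne_zero) (x₀ + s • (ω : EuclideanSpace ℝ (Fin n)))
        ).hasFDerivAt.comp_hasDerivAt s (hline s)
      rw [gradient, InnerProductSpace.toDual_symm_apply]
      exact this
    have hω : ‖(ω : EuclideanSpace ℝ (Fin n))‖ = 1 := by simp
    have := sq_intervalIntegral_deriv_le (m := n - 1) hd hr.1 hr.2 hder (by fun_prop)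
      (p := fun s => F (x₀ + s • (ω : EuclideanSpace ℝ (Fin n)))) (by fun_prop) fun s => by
        have h1 := abs_real_inner_le_norm (gradient u (x₀ + s • (ω : EuclideanSpace ℝ (Fin n)))) ω
        rw [hω, mul_one] at h1
        rw [← sq_abs]
        exact pow_le_pow_left₀ (abs_nonneg _) h1 2
    rw [hG]
    exact this
  have hLG : Integrable (fun p : _ × Ioi (0 : ℝ) => L * G p.1) P := (hGi.const_mul L).comp_fst ν
  have hf2 : Integrable (fun p => f p ^ 2) P := by
    refine hLG.mono' (hfi.aestronglyMeasurable.pow 2) ?_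
    filter_upwards [hbound] with p hp
    rwa [Real.norm_of_nonneg (sq_nonneg _)]
  have hjen : (∫ p, f p ∂P) ^ 2 ≤ P.real univ * ∫ p, f p ^ 2 ∂P := by
    have := sq_integral_mul_le (μ := P) (f := fun _ => 1) (g := f) (by simp) hf2 (by simpa using hfi)
    simpa using this
  have hf2le : ∫ p, f p ^ 2 ∂P ≤ ν.real univ * (L * ∫ x in A, F x) := by
    refine (integral_mono_ae hf2 hLG hbound).trans (le_of_eq ?_)
    rw [hP, integral_fun_fst (fun ω => L * G ω), integral_const_mul, hGe, smul_eq_mul]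
  have hPpos : 0 < P.real univ := by rw [hPr]; exact mul_pos hσ hνpos
  have hFnn : 0 ≤ ∫ x in A, F x := integral_nonneg fun x => sq_nonneg _
  have hLle := intervalIntegral_inv_pow_le hn hd hdρ.le (by linarith)
  rw [← hL] at hLle
  have hv : ⨍ ω : sphere (0 : EuclideanSpace ℝ (Fin n)) 1,
      u (x₀ + d • (ω : EuclideanSpace ℝ (Fin n))) ∂σ = ⨍ ω, v ω ∂σ := rfl
  rw [hv, hdiff, sq_abs]
  calc ((P.real univ)⁻¹ * ∫ p, f p ∂P) ^ 2
      = (P.real univ)⁻¹ ^ 2 * (∫ p, f p ∂P) ^ 2 := mul_pow _ _ _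
    _ ≤ (P.real univ)⁻¹ ^ 2 * (P.real univ * (ν.real univ * (L * ∫ x in A, F x))) := by
      gcongr
      exact hjen.trans (mul_le_mul_of_nonneg_left hf2le hPpos.le)
    _ = (σ.real univ)⁻¹ * L * ∫ x in A, F x := by rw [hPr]; field_simp
    _ ≤ (σ.real univ)⁻¹ * (d ^ ((2 : ℝ) - n) * (if n = 2 then |Real.log d| else 1))
        * ∫ x in A, F x := by gcongr
    _ = _ := by ring
end
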